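/- arXiv:1712.10133 — 3 statements merged into one kernel-verified Lean document; each statement's English description precedes it below -/
import Mathlib

section
/- Let Γ be a countable discrete group with trivial amenable radical, and let Λ ≤ Γ be a co-amenable subgroup. Then a probability measure preserving action of Γ on a standard probability space (X, m) is essentially free whenever its restriction to Λ is essentially free. -/
noncomputable section
open scoped ComplexOrder ENNReal
open MeasureTheory Filter Topology
set_option linter.unusedSectionVars false
set_option maxHeartbeats 1000000
set_option synthInstance.maxHeartbeats 400000

namespace RW

/-- A probability distribution on a (countable discrete) group. -/
structure ProbOn (Γ : Type*) where
  w : Γ → ℝ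
  nonneg : ∀ g, 0 ≤ w g
  hasSum : HasSum w 1

/-- `μ` is generating: the semigroup generated by its support is the whole group. -/
def ProbOn.Generating {Γ : Type*} [Group Γ] (μ : ProbOn Γ) : Prop :=
  ∀ g : Γ, ∃ l : List Γ, l ≠ [] ∧ (∀ x ∈ l, 0 < μ.w x) ∧ l.prod = g

section Amenable

/-- ℓ∞ translation of a bounded function under a group action. -/
def lpShift {G S : Type*} [Group G] [MulAction G S] (g : G)
    (f : lp (fun _ : S => ℝ) ∞) : lp (fun _ : S => ℝ) ∞ :=
  ⟨fun x => f (g⁻¹ • x), by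
    have h : Memℓp (f : ∀ _ : S, ℝ) ∞ := lp.memℓp f
    rw [memℓp_infty_iff] at h
    refine memℓp_infty (BddAbove.mono ?_ h)
    rintro _ ⟨x, rfl⟩
    exact ⟨g⁻¹ • x, rfl⟩⟩

/-- Existence of an invariant mean on `ℓ∞(S)` for an action of `G` on `S`: a positive,
unital, `G`-invariant linear functional. -/
def HasInvariantMean (G S : Type*) [Group G] [MulAction G S] : Prop :=
  ∃ m : (lp (fun _ : S => ℝ) ∞) →ₗ[ℝ] ℝ,
    (∀ f, (∀ x, 0 ≤ f x) → 0 ≤ m f) ∧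
    m 1 = 1 ∧
    (∀ (g : G) (f), m (lpShift g f) = m f)

/-- A group is amenable if `ℓ∞` of it carries a left-invariant mean. -/
def IsAmenable (G : Type*) [Group G] : Prop := HasInvariantMean G G

/-- A subgroup is co-amenable if there is a `Γ`-invariant mean on `ℓ∞(Γ/Λ)`. -/
def IsCoamenable {Γ : Type*} [Group Γ] (Λ : Subgroup Γ) : Prop :=
  HasInvariantMean Γ (Γ ⧸ Λ)

/-- `Γ` has trivial amenable radical: it has no non-trivial amenable normal subgroup. -/
def HasTrivialAmenableRadical (Γ : Type*) [Group Γ] : Prop :=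
  ∀ N : Subgroup Γ, N.Normal → IsAmenable ↥N → N = ⊥

end Amenable

section Meas

variable {Γ : Type*} [Group Γ] {X : Type*} [MeasurableSpace X] [MulAction Γ X]

/-- `ν` is `μ`-stationary: `ν = ∑_g μ(g) g_*ν`. -/
def IsStatMeasure (μ : ProbOn Γ) (ν : Measure X) : Prop :=
  ν = Measure.sum (fun g : Γ => ENNReal.ofReal (μ.w g) • Measure.map (fun x : X => g • x) ν)

/-- Position of the `(Γ,μ)`-random walk at time `n`, given the sequence of increments. -/
def walk (x : ℕ → Γ) (n : ℕ) : Γ := (List.ofFn (fun i : Fin n => x i)).prod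

/-- `P` is the Bernoulli measure `μ^⊗ℕ` on the space of increments of the random walk;
the path measure ℙ_μ is its push-forward under partial products. -/
def IsBernoulli [MeasurableSpace Γ] (μ : ProbOn Γ) (P : Measure (ℕ → Γ)) : Prop :=
  IsProbabilityMeasure P ∧
  ∀ (n : ℕ) (s : Fin n → Γ), P {x | ∀ i : Fin n, x (i : ℕ) = s i}
      = ∏ i, ENNReal.ofReal (μ.w (s i))

/-- Essential freeness of an action on a measure space. -/
def IsEssFree (Γ : Type*) [Group Γ] {X : Type*} [MeasurableSpace X] [MulAction Γ X]
    (ν : Measure X) : Prop :=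
  ∀ g : Γ, g ≠ 1 → ν {x : X | g • x = x} = 0

/-- Essential freeness of the restriction of the action to a subgroup. -/
def IsEssFreeOn (Λ : Subgroup Γ) (ν : Measure X) : Prop :=
  ∀ h : Γ, h ∈ Λ → h ≠ 1 → ν {x : X | h • x = x} = 0

/-- The action is non-singular: each translate of `ν` is equivalent to `ν`. -/
def IsNonSingular (Γ : Type*) [Group Γ] {X : Type*} [MeasurableSpace X] [MulAction Γ X]
    (ν : Measure X) : Prop :=
  ∀ g : Γ, Measure.map (fun x : X => g • x) ν ≪ ν ∧ ν ≪ Measure.map (fun x : X => g • x) ν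

end Meas

end RW

namespace RW

section Sublinear

variable {G V : Type*} [Group G] [AddCommGroup V] [Module ℝ V]

/-- A real-valued sublinear functional invariant under a linear representation. -/
structure IsInvSublinear (ρ : Representation ℝ G V) (p : V → ℝ) : Prop where
  smul : ∀ c : ℝ, 0 < c → ∀ v, p (c • v) = c * p v
  add_le : ∀ v w, p (v + w) ≤ p v + p w
  inv : ∀ g v, p (ρ g v) = p v

namespace IsInvSublinear

variable {ρ : Representation ℝ G V} {p : V → ℝ}

lemma map_zero (hp : IsInvSublinear ρ p) : p 0 = 0 := by
  have := hp.smul 2 two_pos 0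
  rw [smul_zero] at this
  linarith

lemma neg_le (hp : IsInvSublinear ρ p) (v : V) : -p (-v) ≤ p v := by
  have := hp.add_le v (-v)
  rw [add_neg_cancel, hp.map_zero] at this
  linarith

lemma exists_linear_le (hp : IsInvSublinear ρ p) : ∃ φ : V →ₗ[ℝ] ℝ, ∀ v, φ v ≤ p v := by
  obtain ⟨φ, -, h⟩ := exists_extension_of_le_sublinear (⊥ : V →ₗ.[ℝ] ℝ) p hp.smul hp.add_le (by
    rintro ⟨x, hx⟩
    obtain rfl : x = 0 := (Submodule.mem_bot ℝ).1 hx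
    rw [hp.map_zero]
    exact (LinearPMap.map_zero _).le)
  exact ⟨φ, h⟩

/-- Zorn's lemma: below an invariant sublinear functional there is a minimal one. -/
lemma exists_minimal (hp : IsInvSublinear ρ p) :
    ∃ q, IsInvSublinear ρ q ∧ q ≤ p ∧ ∀ r, IsInvSublinear ρ r → r ≤ q → q ≤ r := by
  let S : Set (V → ℝ)ᵒᵈ := {q | IsInvSublinear ρ (OrderDual.ofDual q) ∧ OrderDual.ofDual q ≤ p}
  have key : ∀ c ⊆ S, IsChain (· ≤ ·) c → ∀ y ∈ c, ∃ ub ∈ S, ∀ z ∈ c, z ≤ ub := by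
    intro c hcS hc y hy
    let ev : c → V → ℝ := fun q => OrderDual.ofDual q.1
    have : Nonempty c := ⟨⟨y, hy⟩⟩
    have hev (i : c) : IsInvSublinear ρ (ev i) := (hcS i.2).1
    have hevp (i : c) : ev i ≤ p := (hcS i.2).2
    have hbdd (v : V) : BddBelow (Set.range fun i => ev i v) := by
      refine ⟨-p (-v), ?_⟩
      rintro _ ⟨i, rfl⟩
      linarith [(hev i).neg_le v, hevp i (-v)]
    let q : V → ℝ := fun v => ⨅ i, ev i v
    have hq (i : c) : q ≤ ev i := fun v => ciInf_le (hbdd v) i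
    refine ⟨OrderDual.toDual q, ⟨⟨?_, ?_, ?_⟩, ?_⟩, fun z hz => hq ⟨z, hz⟩⟩
    · intro a ha v
      change (⨅ i, ev i (a • v)) = a * ⨅ i, ev i v
      rw [Real.mul_iInf_of_nonneg ha.le]
      exact iInf_congr fun i => (hev i).smul a ha v
    · intro v w
      change (⨅ i, ev i (v + w)) ≤ (⨅ i, ev i v) + ⨅ i, ev i w
      refine le_ciInf_add_ciInf fun i j => ?_
      rcases hc.total i.2 j.2 with h | h
      · exact (ciInf_le (hbdd _) j).trans (((hev j).add_le v w).trans
          (add_le_add_left (h v) _))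
      · exact (ciInf_le (hbdd _) i).trans (((hev i).add_le v w).trans
          (add_le_add_right (h w) _))
    · intro g v
      exact iInf_congr fun i => (hev i).inv g v
    · exact (hq ⟨y, hy⟩).trans (hevp _)
  obtain ⟨q, -, hqS, hq⟩ := zorn_le_nonempty₀ S key (OrderDual.toDual p) ⟨hp, le_rfl⟩
  exact ⟨OrderDual.ofDual q, hqS.1, hqS.2, fun r hr hrq =>
    hq (y := OrderDual.toDual r) ⟨hr, le_trans hrq hqS.2⟩ hrq⟩

/-- The elements acting trivially on all linear functionals dominated by `p`. -/
def kernel (hp : IsInvSublinear ρ p) : Subgroup G where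
  carrier := {g | ∀ v, p (v - ρ g v) ≤ 0}
  one_mem' v := by simp [hp.map_zero]
  mul_mem' {a b} ha hb v := by
    have h := hp.add_le (v - ρ b v) (ρ b v - ρ a (ρ b v))
    rw [sub_add_sub_cancel] at h
    rw [map_mul]
    exact h.trans (add_nonpos (hb v) (ha _))
  inv_mem' {a} ha v := by
    have h := ha (-ρ a⁻¹ v)
    have e : ρ a (ρ a⁻¹ v) = v := by simp
    rw [map_neg, e] at h
    convert h using 2
    abel

lemma mem_kernel (hp : IsInvSublinear ρ p) {g : G} :
    g ∈ hp.kernel ↔ ∀ v, p (v - ρ g v) ≤ 0 := Iff.rfl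

lemma kernel_normal (hp : IsInvSublinear ρ p) : hp.kernel.Normal where
  conj_mem n hn g v := by
    have h := hn (ρ g⁻¹ v)
    rw [← hp.inv g, map_sub] at h
    simpa [map_mul] using h

lemma apply_eq_of_mem_kernel (hp : IsInvSublinear ρ p) {φ : V →ₗ[ℝ] ℝ} (hφ : ∀ v, φ v ≤ p v)
    {g : G} (hg : g ∈ hp.kernel) (v : V) : φ (ρ g v) = φ v := by
  have h1 := (hφ _).trans (hg v)
  have h2 := (hφ _).trans (hg (-v))
  simp only [map_sub, map_neg] at h1 h2
  linarith

/-- Averaging a dominated functional over an amenable subgroup. -/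
lemma exists_invariant_le (hp : IsInvSublinear ρ p) {K : Subgroup G} (hK : IsAmenable K) :
    ∃ φ : V →ₗ[ℝ] ℝ, (∀ v, φ v ≤ p v) ∧ ∀ k ∈ K, ∀ v, φ (ρ k v) = φ v := by
  obtain ⟨φ, hφ⟩ := hp.exists_linear_le
  obtain ⟨M, hpos, hone, hinv⟩ := hK
  have hle (g : G) (v : V) : φ (ρ g v) ≤ p v := (hφ _).trans (hp.inv g v).le
  have hmem (v : V) : Memℓp (fun k : K => φ (ρ (k : G)⁻¹ v)) ∞ := by
    refine memℓp_infty ⟨max (p v) (p (-v)), ?_⟩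
    rintro _ ⟨k, rfl⟩
    refine abs_le'.2 ⟨(hle _ v).trans (le_max_left _ _), le_trans ?_ (le_max_right _ _)⟩
    have := hle (k : G)⁻¹ (-v)
    rwa [map_neg, map_neg] at this
  let A : V →ₗ[ℝ] lp (fun _ : K => ℝ) ∞ :=
    { toFun := fun v => ⟨fun k : K => φ (ρ (k : G)⁻¹ v), hmem v⟩
      map_add' := fun v w => by
        ext k
        change φ (ρ (k : G)⁻¹ (v + w)) = φ (ρ (k : G)⁻¹ v) + φ (ρ (k : G)⁻¹ w)
        simp
      map_smul' := fun c v => by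
        ext k
        change φ (ρ (k : G)⁻¹ (c • v)) = c • φ (ρ (k : G)⁻¹ v)
        simp }
  refine ⟨M ∘ₗ A, fun v => ?_, fun k hk v => ?_⟩
  · have h := hpos (p v • 1 - A v) fun k => by
      change 0 ≤ p v • (1 : ℝ) - φ (ρ (k : G)⁻¹ v)
      simpa using hle _ v
    rw [map_sub, map_smul, hone, smul_eq_mul, mul_one] at h
    exact sub_nonneg.1 h
  · change M (A (ρ k v)) = M (A v)
    rw [← hinv ⟨k, hk⟩ (A v)]
    congr 1
    ext l
    change φ (ρ (l : G)⁻¹ (ρ k v)) = φ (ρ (((⟨k, hk⟩ : K)⁻¹ * l : K) : G)⁻¹ v)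
    simp [map_mul]

end IsInvSublinear

end Sublinear

section FreeActions

/-- Translation of bounded functions as a linear representation. -/
def shiftRep (G S : Type*) [Group G] [MulAction G S] :
    Representation ℝ G (lp (fun _ : S => ℝ) ∞) where
  toFun g :=
    { toFun := lpShift g
      map_add' := fun _ _ => rfl
      map_smul' := fun _ _ => rfl }
  map_one' := by
    ext f s
    change f ((1 : G)⁻¹ • s) = f s
    simp
  map_mul' a b := by
    ext f s
    change f ((a * b)⁻¹ • s) = f (b⁻¹ • a⁻¹ • s)
    rw [mul_inv_rev, mul_smul]

/-- A group acting freely on a set with an invariant mean is amenable. -/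
lemma isAmenable_of_free {G S : Type*} [Group G] [MulAction G S] (h : HasInvariantMean G S)
    (hfree : ∀ (g : G) (s : S), g • s = s → g = 1) : IsAmenable G := by
  obtain ⟨M, hpos, hone, hinv⟩ := h
  have hrep (s : S) : ∃ g : G, g • (Quotient.out (Quotient.mk (MulAction.orbitRel G S) s)) = s :=
    (MulAction.orbitRel G S).symm (Quotient.mk_out (s := MulAction.orbitRel G S) s)
  choose r hr using hrep
  have hr_smul (g : G) (s : S) : r (g • s) = g * r s := by
    have e : Quotient.mk (MulAction.orbitRel G S) (g • s) = Quotient.mk _ s :=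
      Quotient.sound ⟨g, rfl⟩
    have h1 := hr (g • s)
    rw [e] at h1
    have h2 : ((g * r s)⁻¹ * r (g • s)) •
        (Quotient.out (Quotient.mk (MulAction.orbitRel G S) s)) =
        Quotient.out (Quotient.mk (MulAction.orbitRel G S) s) := by
      rw [mul_smul, h1, inv_smul_eq_iff, mul_smul, hr]
    exact (inv_mul_eq_one.1 (hfree _ _ h2)).symm
  let R : lp (fun _ : G => ℝ) ∞ →ₗ[ℝ] lp (fun _ : S => ℝ) ∞ :=
    { toFun := fun f => ⟨fun s => f (r s), by
        have hf := memℓp_infty_iff.1 (lp.memℓp f)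
        refine memℓp_infty (hf.mono ?_)
        rintro _ ⟨s, rfl⟩
        exact ⟨r s, rfl⟩⟩
      map_add' := fun _ _ => rfl
      map_smul' := fun _ _ => rfl }
  refine ⟨M ∘ₗ R, fun f hf => hpos _ fun s => hf (r s), hone, fun g f => ?_⟩
  change M (R (lpShift g f)) = M (R f)
  rw [← hinv g (R f)]
  congr 1
  ext s
  change f (g⁻¹ * r s) = f (r (g⁻¹ • s))
  rw [hr_smul]

/-- The supremum is an invariant sublinear functional on bounded functions. -/
lemma isInvSublinear_iSup (G S : Type*) [Group G] [MulAction G S] [Nonempty S] :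
    IsInvSublinear (shiftRep G S) fun f => ⨆ s, f s := by
  have hb (f : lp (fun _ : S => ℝ) ∞) : BddAbove (Set.range fun s => f s) := by
    obtain ⟨C, hC⟩ := memℓp_infty_iff.1 (lp.memℓp f)
    refine ⟨C, ?_⟩
    rintro _ ⟨s, rfl⟩
    exact (le_abs_self _).trans (hC ⟨s, rfl⟩)
  refine ⟨fun c hc f => ?_, fun f g => ?_, fun g f => ?_⟩
  · exact (Real.mul_iSup_of_nonneg hc.le _).symm
  · exact ciSup_le fun s => add_le_add (le_ciSup (hb f) s) (le_ciSup (hb g) s)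
  · exact (MulAction.toPerm g⁻¹).iSup_comp (g := fun s => f s)

/-- The kernel of an invariant sublinear functional dominated by the supremum is amenable. -/
lemma isAmenable_kernel {G : Type*} [Group G] {p : lp (fun _ : G => ℝ) ∞ → ℝ}
    (hp : IsInvSublinear (shiftRep G G) p) (hle : ∀ f, p f ≤ ⨆ s, f s) :
    IsAmenable hp.kernel := by
  obtain ⟨φ, hφ⟩ := hp.exists_linear_le
  refine isAmenable_of_free (S := G) ⟨φ, fun f hf => ?_, le_antisymm ?_ ?_, fun g f => ?_⟩
    fun g s h => Subtype.ext (mul_eq_right.1 h)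
  · have h : φ (-f) ≤ 0 := ((hφ _).trans (hle _)).trans (ciSup_le fun s => neg_nonpos.2 (hf s))
    rw [map_neg] at h
    linarith
  · exact ((hφ _).trans (hle _)).trans (ciSup_le fun s => le_rfl)
  · have h : φ (-1) ≤ -1 := ((hφ _).trans (hle _)).trans (ciSup_le fun s => le_rfl)
    rw [map_neg] at h
    linarith
  · exact hp.apply_eq_of_mem_kernel hφ g.2 f

end FreeActions

section MeasurePreserving

variable {Γ : Type*} [Group Γ] {X : Type*} [MeasurableSpace X] [MulAction Γ X]
  {V : Type*} [AddCommGroup V] [Module ℝ V]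

/-- The linear functionals dominated by `p` and invariant under the stabilizer of `x`. -/
def stabFunctionals (ρ : Representation ℝ Γ V) (p : V → ℝ) (x : X) : Set (V →ₗ[ℝ] ℝ) :=
  {φ | (∀ v, φ v ≤ p v) ∧ ∀ k ∈ MulAction.stabilizer Γ x, ∀ v, φ (ρ k v) = φ v}

/-- The integrable majorants of the support functions of `stabFunctionals` at `v`. -/
def supportMajorants (ρ : Representation ℝ Γ V) (p : V → ℝ) (m : Measure X) (v : V) :
    Set (X → ℝ) :=
  {u | Integrable u m ∧ ∀ᵐ x ∂m, ∀ φ ∈ stabFunctionals ρ p x, φ v ≤ u x}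

/-- The upper integral of the support functions of `stabFunctionals`. -/
def upperSupport (ρ : Representation ℝ Γ V) (p : V → ℝ) (m : Measure X) (v : V) : ℝ :=
  sInf ((fun u : X → ℝ => ∫ x, u x ∂m) '' supportMajorants ρ p m v)

variable {ρ : Representation ℝ Γ V} {p : V → ℝ} {m : Measure X} [IsProbabilityMeasure m]

lemma const_mem_supportMajorants (v : V) : (fun _ => p v) ∈ supportMajorants ρ p m v :=
  ⟨integrable_const _, ae_of_all _ fun _ _ hφ => hφ.1 v⟩

lemma upperSupport_le (hp : IsInvSublinear ρ p)
    (hamen : ∀ᵐ x ∂m, IsAmenable (MulAction.stabilizer Γ x)) {v : V} {u : X → ℝ}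
    (hu : u ∈ supportMajorants ρ p m v) : upperSupport ρ p m v ≤ ∫ x, u x ∂m := by
  refine csInf_le ⟨-p (-v), ?_⟩ ⟨u, hu, rfl⟩
  rintro _ ⟨w, ⟨hwi, hw⟩, rfl⟩
  have h : ∫ _, -p (-v) ∂m ≤ ∫ x, w x ∂m := by
    refine integral_mono_ae (integrable_const _) hwi ?_
    filter_upwards [hw, hamen] with x hx hax
    obtain ⟨φ, hφ⟩ := hp.exists_invariant_le hax
    have h1 := hφ.1 (-v)
    rw [map_neg] at h1
    have h2 := hx φ hφ
    linarith
  simpa using h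

lemma le_upperSupport {v : V} {a : ℝ}
    (h : ∀ u ∈ supportMajorants ρ p m v, a ≤ ∫ x, u x ∂m) : a ≤ upperSupport ρ p m v := by
  refine le_csInf ⟨_, _, const_mem_supportMajorants v, rfl⟩ ?_
  rintro _ ⟨u, hu, rfl⟩
  exact h u hu

lemma comp_mem_stabFunctionals (hp : IsInvSublinear ρ p) {g : Γ} {x : X} {φ : V →ₗ[ℝ] ℝ}
    (hφ : φ ∈ stabFunctionals ρ p x) : φ ∘ₗ ρ g ∈ stabFunctionals ρ p (g⁻¹ • x) := by
  refine ⟨fun v => (hφ.1 _).trans (hp.inv g v).le, fun k hk v => ?_⟩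
  have hk' : g * k * g⁻¹ ∈ MulAction.stabilizer Γ x := by
    rw [MulAction.mem_stabilizer_iff] at hk ⊢
    rw [mul_smul, mul_smul, hk, smul_inv_smul]
  have h := hφ.2 _ hk' (ρ g v)
  simpa [map_mul] using h

lemma isInvSublinear_upperSupport (hp : IsInvSublinear ρ p)
    (hamen : ∀ᵐ x ∂m, IsAmenable (MulAction.stabilizer Γ x))
    (hmp : ∀ g : Γ, MeasurePreserving (fun x : X => g • x) m m) :
    IsInvSublinear ρ (upperSupport ρ p m) := by
  have smul_le (c : ℝ) (hc : 0 < c) (v : V) :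
      upperSupport ρ p m (c • v) ≤ c * upperSupport ρ p m v := by
    rw [← div_le_iff₀' hc]
    refine le_upperSupport fun u hu => ?_
    rw [div_le_iff₀' hc, ← integral_const_mul]
    refine upperSupport_le hp hamen ⟨hu.1.const_mul c, ?_⟩
    filter_upwards [hu.2] with x hx φ hφ
    rw [map_smul, smul_eq_mul]
    exact mul_le_mul_of_nonneg_left (hx φ hφ) hc.le
  have le_inv (g : Γ) (v : V) : upperSupport ρ p m (ρ g v) ≤ upperSupport ρ p m v := by
    refine le_upperSupport fun u hu => ?_
    have hg := hmp g⁻¹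
    have hint : ∫ x, u (g⁻¹ • x) ∂m = ∫ x, u x ∂m := by
      have h := integral_map (μ := m) (f := u) hg.measurable.aemeasurable
        (by rw [hg.map_eq]; exact hu.1.aestronglyMeasurable)
      rw [hg.map_eq] at h
      exact h.symm
    rw [← hint]
    refine upperSupport_le hp hamen ⟨hg.integrable_comp_of_integrable hu.1, ?_⟩
    filter_upwards [hg.quasiMeasurePreserving.ae hu.2] with x hx φ hφ
    exact hx _ (comp_mem_stabFunctionals hp hφ)
  refine ⟨fun c hc v => (smul_le c hc v).antisymm ?_, fun v w => ?_,
    fun g v => (le_inv g v).antisymm ?_⟩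
  · have h := smul_le c⁻¹ (inv_pos.2 hc) (c • v)
    rwa [inv_smul_smul₀ hc.ne', le_inv_mul_iff₀ hc] at h
  · rw [← sub_le_iff_le_add']
    refine le_upperSupport fun u hu => ?_
    rw [sub_le_iff_le_add', ← sub_le_iff_le_add]
    refine le_upperSupport fun t ht => ?_
    rw [sub_le_iff_le_add, ← integral_add ht.1 hu.1]
    refine upperSupport_le hp hamen ⟨ht.1.add hu.1, ?_⟩
    filter_upwards [hu.2, ht.2] with x hx hx' φ hφ
    rw [map_add]
    exact add_le_add (hx' φ hφ) (hx φ hφ)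
  · have h := le_inv g⁻¹ (ρ g v)
    have e : ρ g⁻¹ (ρ g v) = v := by simp
    rwa [e] at h

/-- If almost all stabilizers are amenable, an element fixing a set of positive measure acts
trivially on the functionals dominated by a minimal invariant sublinear functional. -/
lemma mem_kernel_of_measure_fixed_ne_zero (hp : IsInvSublinear ρ p)
    (hmin : ∀ q, IsInvSublinear ρ q → q ≤ p → p ≤ q)
    (hamen : ∀ᵐ x ∂m, IsAmenable (MulAction.stabilizer Γ x))
    (hmp : ∀ g : Γ, MeasurePreserving (fun x : X => g • x) m m) {g : Γ}
    (hmeas : MeasurableSet {x : X | g • x = x}) (hg : m {x : X | g • x = x} ≠ 0) :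
    g ∈ hp.kernel := by
  intro v
  set c := p (v - ρ g v)
  set F := {x : X | g • x = x}
  have hle : upperSupport ρ p m ≤ p := fun w => by
    simpa using upperSupport_le hp hamen (const_mem_supportMajorants (m := m) w)
  have h1 : c ≤ upperSupport ρ p m (v - ρ g v) :=
    hmin _ (isInvSublinear_upperSupport hp hamen hmp) hle _
  have h2 : upperSupport ρ p m (v - ρ g v) ≤ ∫ x, Fᶜ.indicator (fun _ => c) x ∂m := by
    refine upperSupport_le hp hamen
      ⟨(integrable_const c).indicator hmeas.compl, ae_of_all _ fun x φ hφ => ?_⟩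
    by_cases hx : x ∈ F
    · rw [Set.indicator_of_notMem (Set.notMem_compl_iff.2 hx), map_sub, hφ.2 g hx, sub_self]
    · rw [Set.indicator_of_mem hx]
      exact hφ.1 _
  rw [integral_indicator_const _ hmeas.compl, smul_eq_mul, probReal_compl_eq_one_sub hmeas] at h2
  have h3 : 0 < m.real F := ENNReal.toReal_pos hg (measure_ne_top _ _)
  nlinarith

/-- Stabilizers are almost surely amenable when a co-amenable subgroup acts essentially freely. -/
lemma ae_isAmenable_stabilizer [Countable Γ] {Λ : Subgroup Γ} (hco : IsCoamenable Λ)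
    (hmp : ∀ g : Γ, MeasurePreserving (fun x : X => g • x) m m) (hΛ : IsEssFreeOn Λ m) :
    ∀ᵐ x ∂m, IsAmenable (MulAction.stabilizer Γ x) := by
  have h : ∀ᵐ x ∂m, ∀ (g : Γ) (h : Γ), h ∈ Λ → h • g⁻¹ • x = g⁻¹ • x → h = 1 := by
    refine ae_all_iff.2 fun g => ae_all_iff.2 fun h => ?_
    by_cases hh : h ∈ Λ ∧ h ≠ 1
    · have h0 : ∀ᵐ y ∂m, h • y ≠ y := by
        rw [ae_iff]
        simpa using hΛ h hh.1 hh.2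
      filter_upwards [(hmp g⁻¹).quasiMeasurePreserving.ae h0] with x hx _ hx'
      exact absurd hx' hx
    · exact ae_of_all _ fun x hmem _ => by_contra fun hne => hh ⟨hmem, hne⟩
  filter_upwards [h] with x hx
  obtain ⟨M, hpos, hone, hinv⟩ := hco
  refine isAmenable_of_free (S := Γ ⧸ Λ) ⟨M, hpos, hone, fun k f => hinv k f⟩ ?_
  rintro ⟨k, hk⟩ s hs
  induction s using QuotientGroup.induction_on with
  | H g =>
    have h1 : (QuotientGroup.mk g : Γ ⧸ Λ) = QuotientGroup.mk (k * g) := hs.symm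
    rw [QuotientGroup.eq] at h1
    have h2 := hx g _ h1 (by
      rw [mul_smul, mul_smul, smul_inv_smul, MulAction.mem_stabilizer_iff.1 hk])
    ext
    rw [inv_mul_eq_one] at h2
    exact mul_eq_right.1 h2.symm

end MeasurePreserving

end RW

open RW in
/-- For `Γ` with trivial amenable radical and a co-amenable subgroup `Λ`, a probability
measure preserving action is essentially free as soon as its restriction to `Λ` is. -/
theorem coamenable_relative_freeness_pmp
    {Γ : Type*} [Group Γ] [Countable Γ]
    (hrad : HasTrivialAmenableRadical Γ)
    (Λ : Subgroup Γ) (hco : IsCoamenable Λ)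
    {X : Type*} [MeasurableSpace X] [StandardBorelSpace X] [MulAction Γ X]
    (hmeas : ∀ g : Γ, Measurable fun x : X => g • x)
    (m : Measure X) [IsProbabilityMeasure m]
    (hpmp : ∀ g : Γ, Measure.map (fun x : X => g • x) m = m)
    (hΛfree : IsEssFreeOn Λ m) :
    IsEssFree Γ m := by
  have hmp (g : Γ) : MeasurePreserving (fun x : X => g • x) m m := ⟨hmeas g, hpmp g⟩
  obtain ⟨p, hp, hle, hmin⟩ := (isInvSublinear_iSup Γ Γ).exists_minimal
  intro g hg
  by_contra h
  have hker := mem_kernel_of_measure_fixed_ne_zero hp hmin (ae_isAmenable_stabilizer hco hmp hΛfree)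
    hmp (measurableSet_eq_fun (hmeas g) measurable_id) h
  rw [hrad _ hp.kernel_normal (isAmenable_kernel hp hle), Subgroup.mem_bot] at hker
  exact hg hker
end
end

section
/- Let Γ be a countable discrete group with trivial amenable radical, and let Λ ≤ Γ be a co-amenable subgroup. Then the pair (Γ, Λ) is tracial rigid: every character of Γ which restricts to δ_e on Λ equals δ_e. That is, if φ: Γ → ℂ is positive definite, φ(e) = 1, φ(h g h⁻¹) = φ(g) for all g, h ∈ Γ, and φ(h) = 0 for all h ∈ Λ ∖ {e}, then φ(g) = 0 for all g ∈ Γ ∖ {e}. -/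
noncomputable section
open scoped ComplexOrder ENNReal
open MeasureTheory Filter Topology
set_option linter.unusedSectionVars false
set_option maxHeartbeats 1000000
set_option synthInstance.maxHeartbeats 400000

namespace RW

/-- Positive definite functions: all matrices `[φ(g_i g_j⁻¹)]` are positive semidefinite. -/
def IsPosDef {Γ : Type*} [Group Γ] (φ : Γ → ℂ) : Prop :=
  ∀ (n : ℕ) (g : Fin n → Γ) (c : Fin n → ℂ),
    0 ≤ ∑ i, ∑ j, (starRingEnd ℂ) (c i) * c j * φ (g i * (g j)⁻¹)

end RW

namespace RW

/-- The Hilbert space `ℓ²(Γ)`. -/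
abbrev L2 (Γ : Type*) := lp (fun _ : Γ => ℂ) 2

/-- The commutative C⋆-algebra `ℓ∞(Γ)`. -/
abbrev LInf (Γ : Type*) := lp (fun _ : Γ => ℂ) ∞

/-- Bounded operators on `ℓ²(Γ)`. -/
abbrev Op (Γ : Type*) := L2 Γ →L[ℂ] L2 Γ

section Operators

variable {Γ : Type*}

lemma L2.hasSum_norm_sq (v : L2 Γ) : HasSum (fun i => ‖v i‖ ^ 2) (‖v‖ ^ 2) := by
  have h := lp.hasSum_norm (p := 2) (by norm_num) v
  simpa using h

lemma L2.memℓp {w : Γ → ℂ} (hw : Summable fun i => ‖w i‖ ^ 2) : Memℓp w 2 :=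
  memℓp_gen (by simpa using hw)

lemma L2.norm_sq_le {w : L2 Γ} {f : Γ → ℝ} {S : ℝ} (hf : HasSum f S)
    (h : ∀ i, ‖w i‖ ^ 2 ≤ f i) : ‖w‖ ^ 2 ≤ S :=
  hasSum_le h (L2.hasSum_norm_sq w) hf

lemma LInf.memℓp {f : Γ → ℂ} {C : ℝ} (hf : ∀ i, ‖f i‖ ≤ C) : Memℓp f ∞ :=
  memℓp_infty ⟨C, by rintro _ ⟨i, rfl⟩; exact hf i⟩

lemma LInf.norm_apply_le (f : LInf Γ) (i : Γ) : ‖f i‖ ≤ ‖f‖ :=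
  lp.norm_apply_le_norm (by simp) f i

/-- The multiplication operators on `ℓ²(Γ)`. -/
def mulOp : LInf Γ →L[ℂ] Op Γ :=
  LinearMap.mkContinuous₂ (LinearMap.mk₂ ℂ
    (fun (f : LInf Γ) (v : L2 Γ) => (⟨fun i => f i * v i, L2.memℓp <| by
        refine Summable.of_nonneg_of_le (fun i => by positivity) (fun i => ?_)
          ((L2.hasSum_norm_sq v).summable.mul_left (‖f‖ ^ 2))
        rw [norm_mul, mul_pow]
        gcongr
        exact LInf.norm_apply_le f i⟩ : L2 Γ))
    (fun f g v => lp.ext <| funext fun i => by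
      simp only [lp.coeFn_add, Pi.add_apply]; exact add_mul _ _ _)
    (fun c f v => lp.ext <| funext fun i => by
      simp only [lp.coeFn_smul, Pi.smul_apply, smul_eq_mul]; exact mul_assoc _ _ _)
    (fun f v w => lp.ext <| funext fun i => by
      simp only [lp.coeFn_add, Pi.add_apply]; exact mul_add _ _ _)
    (fun c f v => lp.ext <| funext fun i => by
      simp only [lp.coeFn_smul, Pi.smul_apply, smul_eq_mul]; exact mul_left_comm _ _ _))
    1 (fun f v => by
      rw [one_mul]
      refine le_of_sq_le_sq ?_ (by positivity)
      rw [mul_pow]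
      refine L2.norm_sq_le ((L2.hasSum_norm_sq v).mul_left (‖f‖ ^ 2)) (fun i => ?_)
      change ‖f i * v i‖ ^ 2 ≤ _
      rw [norm_mul, mul_pow]
      gcongr
      exact LInf.norm_apply_le f i)

@[simp] lemma mulOp_apply (f : LInf Γ) (v : L2 Γ) (i : Γ) : mulOp f v i = f i * v i := rfl

lemma norm_mulOp_le (f : LInf Γ) : ‖mulOp f‖ ≤ ‖f‖ := by
  refine ContinuousLinearMap.opNorm_le_bound _ (norm_nonneg _) (fun v => ?_)
  refine le_of_sq_le_sq ?_ (by positivity)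
  rw [mul_pow]
  refine L2.norm_sq_le ((L2.hasSum_norm_sq v).mul_left (‖f‖ ^ 2)) (fun i => ?_)
  rw [mulOp_apply, norm_mul, mul_pow]
  gcongr
  exact LInf.norm_apply_le f i

@[simp] lemma mulOp_one : mulOp (1 : LInf Γ) = 1 := by
  ext v i
  simp [lp.infty_coeFn_one]

variable [Group Γ]

/-- The left regular representation. -/
def shiftOp (g : Γ) : Op Γ :=
  LinearMap.mkContinuous
    { toFun := fun v => (⟨fun i => v (g⁻¹ * i), L2.memℓp
        ((Equiv.mulLeft g⁻¹).summable_iff.mpr (L2.hasSum_norm_sq v).summable)⟩ : L2 Γ)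
      map_add' := fun v w => rfl
      map_smul' := fun c v => rfl }
    1 (fun v => by
      rw [one_mul]
      refine le_of_sq_le_sq ?_ (by positivity)
      exact L2.norm_sq_le ((Equiv.mulLeft g⁻¹).hasSum_iff.mpr (L2.hasSum_norm_sq v))
        (fun i => le_rfl))

@[simp] lemma shiftOp_apply (g : Γ) (v : L2 Γ) (i : Γ) : shiftOp g v i = v (g⁻¹ * i) := rfl

lemma norm_shiftOp_le (g : Γ) : ‖shiftOp g‖ ≤ 1 := LinearMap.mkContinuous_norm_le _ zero_le_one _

@[simp] lemma shiftOp_one : shiftOp (1 : Γ) = 1 := by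
  ext v i
  simp

lemma shiftOp_mul (g h : Γ) : shiftOp (g * h) = shiftOp g * shiftOp h := by
  ext v i
  simp [mul_assoc]

lemma shiftOp_single [DecidableEq Γ] (g h : Γ) (c : ℂ) :
    shiftOp g (lp.single 2 h c) = lp.single 2 (g * h) c := by
  ext i
  simp only [shiftOp_apply, lp.single_apply, Pi.single_apply, inv_mul_eq_iff_eq_mul]

lemma adjoint_shiftOp (g : Γ) : ContinuousLinearMap.adjoint (shiftOp g) = shiftOp g⁻¹ := by
  symm
  rw [ContinuousLinearMap.eq_adjoint_iff]
  intro v w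
  rw [lp.inner_eq_tsum, lp.inner_eq_tsum, ← (Equiv.mulLeft g⁻¹).tsum_eq]
  simp

/-- Left translation on `ℓ∞(Γ)`. -/
def translate (g : Γ) (f : LInf Γ) : LInf Γ :=
  ⟨fun i => f (g⁻¹ * i), LInf.memℓp (fun i => LInf.norm_apply_le f (g⁻¹ * i))⟩

@[simp] lemma translate_apply (g : Γ) (f : LInf Γ) (i : Γ) : translate g f i = f (g⁻¹ * i) := rfl

lemma shiftOp_mul_mulOp (g : Γ) (f : LInf Γ) :
    shiftOp g * mulOp f = mulOp (translate g f) * shiftOp g := by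
  ext v i
  simp

/-- Conjugation by the left regular representation. -/
def conjOp (g : Γ) : Op Γ →L[ℂ] Op Γ :=
  LinearMap.mkContinuous
    { toFun := fun T => shiftOp g * T * shiftOp g⁻¹
      map_add' := fun S T => by rw [mul_add, add_mul]
      map_smul' := fun c T => by simp }
    1 (fun T => by
      calc ‖shiftOp g * T * shiftOp g⁻¹‖ ≤ ‖shiftOp g‖ * ‖T‖ * ‖shiftOp g⁻¹‖ :=
            (norm_mul_le _ _).trans (by gcongr; exact norm_mul_le _ _)
        _ ≤ 1 * ‖T‖ * 1 := by gcongr <;> exact norm_shiftOp_le _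
        _ = 1 * ‖T‖ := by ring)

lemma conjOp_apply (g : Γ) (T : Op Γ) : conjOp g T = shiftOp g * T * shiftOp g⁻¹ := rfl

lemma norm_conjOp_apply_le (g : Γ) (T : Op Γ) : ‖conjOp g T‖ ≤ ‖T‖ := by
  have := (conjOp g).le_of_opNorm_le (LinearMap.mkContinuous_norm_le _ zero_le_one _) T
  rwa [one_mul] at this

lemma conjOp_conjOp (g h : Γ) (T : Op Γ) : conjOp g (conjOp h T) = conjOp (g * h) T := by
  simp only [conjOp_apply, shiftOp_mul, mul_inv_rev, mul_assoc]

@[simp] lemma shiftOp_mul_shiftOp_inv (g : Γ) : shiftOp g * shiftOp g⁻¹ = 1 := by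
  rw [← shiftOp_mul, mul_inv_cancel, shiftOp_one]

@[simp] lemma shiftOp_inv_mul_shiftOp (g : Γ) : shiftOp g⁻¹ * shiftOp g = 1 := by
  rw [← shiftOp_mul, inv_mul_cancel, shiftOp_one]

@[simp] lemma conjOp_one (g : Γ) : conjOp g (1 : Op Γ) = 1 := by
  simp [conjOp_apply]

@[simp] lemma one_conjOp (T : Op Γ) : conjOp (1 : Γ) T = T := by
  simp [conjOp_apply]

lemma conjOp_shiftOp (g h : Γ) : conjOp g (shiftOp h) = shiftOp (g * h * g⁻¹) := by
  simp only [conjOp_apply, shiftOp_mul]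

lemma conjOp_mulOp (g : Γ) (f : LInf Γ) : conjOp g (mulOp f) = mulOp (translate g f) := by
  rw [conjOp_apply, shiftOp_mul_mulOp, mul_assoc, shiftOp_mul_shiftOp_inv, mul_one]

/-- The orbit function `s ↦ y(s⁻¹ T s)` of a functional `y` on operators. -/
def orbitMap (y : StrongDual ℂ (Op Γ)) : Op Γ →L[ℂ] LInf Γ :=
  LinearMap.mkContinuous
    { toFun := fun T => (⟨fun s => y (conjOp s⁻¹ T), LInf.memℓp (C := ‖y‖ * ‖T‖)
        (fun s => (y.le_opNorm _).trans (by gcongr; exact norm_conjOp_apply_le _ _))⟩ : LInf Γ)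
      map_add' := fun S T => lp.ext <| funext fun s => by
        simp only [lp.coeFn_add, Pi.add_apply, map_add]
      map_smul' := fun c T => lp.ext <| funext fun s => by
        simp only [lp.coeFn_smul, Pi.smul_apply, map_smul, RingHom.id_apply] }
    ‖y‖ (fun T => lp.norm_le_of_forall_le (by positivity)
      (fun s => (y.le_opNorm _).trans (by gcongr; exact norm_conjOp_apply_le _ _)))

@[simp] lemma orbitMap_apply (y : StrongDual ℂ (Op Γ)) (T : Op Γ) (s : Γ) :
    orbitMap y T s = y (conjOp s⁻¹ T) := rfl

lemma norm_orbitMap_le (y : StrongDual ℂ (Op Γ)) : ‖orbitMap y‖ ≤ ‖y‖ :=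
  LinearMap.mkContinuous_norm_le _ (norm_nonneg y) _

lemma translate_orbitMap (y : StrongDual ℂ (Op Γ)) (T : Op Γ) (g : Γ) :
    translate g (orbitMap y T) = orbitMap y (conjOp g T) := by
  ext s
  simp [conjOp_conjOp]

end Operators

end RW

namespace RW

section States

/-- A state on a unital normed algebra: a contractive unital functional. -/
def IsState {E : Type*} [NormedRing E] [NormedAlgebra ℂ E] (μ : StrongDual ℂ E) : Prop :=
  ‖μ‖ ≤ 1 ∧ μ 1 = 1

variable {Γ : Type*}

lemma IsState.norm_apply_le {E : Type*} [NormedRing E] [NormedAlgebra ℂ E] {μ : StrongDual ℂ E}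
    (hμ : IsState μ) (a : E) : ‖μ a‖ ≤ ‖a‖ := by
  simpa using μ.le_of_opNorm_le hμ.1 a

lemma IsState.comp_mulOp {x : StrongDual ℂ (Op Γ)} (hx : IsState x) :
    IsState (x.comp (mulOp (Γ := Γ))) := by
  refine ⟨ContinuousLinearMap.opNorm_le_bound _ zero_le_one fun f => ?_, by simp [hx.2]⟩
  rw [one_mul]
  exact (hx.norm_apply_le _).trans (norm_mulOp_le f)

lemma norm_add_norm_one_sub_le {μ : StrongDual ℂ (LInf Γ)} (hμ : IsState μ) {h f : LInf Γ}
    (h0 : ∀ s, 0 ≤ h s) (h1 : ∀ s, h s ≤ 1) (hf : ‖f‖ ≤ 1) :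
    ‖μ (h * f)‖ + ‖μ (1 - h)‖ ≤ 1 := by
  obtain ⟨a, ha, hae⟩ := Complex.exists_norm_eq_mul_self (μ (h * f))
  obtain ⟨b, hb, hbe⟩ := Complex.exists_norm_eq_mul_self (μ (1 - h))
  have hsum : μ (a • (h * f) + b • (1 - h)) = ((‖μ (h * f)‖ + ‖μ (1 - h)‖ : ℝ) : ℂ) := by
    rw [map_add, map_smul, map_smul, smul_eq_mul, smul_eq_mul, ← hae, ← hbe]
    push_cast
    rfl
  have hn := hμ.norm_apply_le (a • (h * f) + b • (1 - h))
  rw [hsum, Complex.norm_real, Real.norm_of_nonneg (by positivity)] at hn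
  refine hn.trans (lp.norm_le_of_forall_le zero_le_one fun s => ?_)
  have e : (a • (h * f) + b • (1 - h)) s = a * (h s * f s) + b * (1 - h s) := rfl
  have hs : ‖h s‖ + ‖1 - h s‖ = 1 := by
    rw [← Complex.re_eq_norm.mpr (h0 s), ← Complex.re_eq_norm.mpr (sub_nonneg.mpr (h1 s))]
    simp
  rw [e]
  calc ‖a * (h s * f s) + b * (1 - h s)‖ ≤ ‖a * (h s * f s)‖ + ‖b * (1 - h s)‖ := norm_add_le _ _
    _ = ‖h s‖ * ‖f s‖ + ‖1 - h s‖ := by simp only [norm_mul, ha, hb, one_mul]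
    _ ≤ ‖h s‖ * 1 + ‖1 - h s‖ := by
        gcongr
        exact (LInf.norm_apply_le f s).trans hf
    _ = 1 := by rw [mul_one, hs]

lemma IsState.apply_nonneg {μ : StrongDual ℂ (LInf Γ)} (hμ : IsState μ) {h : LInf Γ}
    (h0 : ∀ s, 0 ≤ h s) (h1 : ∀ s, h s ≤ 1) : 0 ≤ μ h := by
  have h := norm_add_norm_one_sub_le hμ (f := 1) h0 h1
    (lp.norm_le_of_forall_le zero_le_one fun s => by simp [lp.infty_coeFn_one])
  rw [mul_one, map_sub, hμ.2] at h
  have h2 := Complex.re_le_norm (1 - μ ‹_›)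
  have h3 := Complex.re_le_norm (μ ‹_›)
  rw [Complex.sub_re, Complex.one_re] at h2
  exact Complex.re_eq_norm.mp (by linarith)

lemma IsState.ofReal_re_apply {μ : StrongDual ℂ (LInf Γ)} (hμ : IsState μ) {h : LInf Γ}
    (h0 : ∀ s, 0 ≤ h s) (h1 : ∀ s, h s ≤ 1) : ((μ h).re : ℂ) = μ h :=
  Complex.ext rfl (Complex.nonneg_iff.mp (hμ.apply_nonneg h0 h1)).2

lemma IsState.norm_apply_mul_le {μ : StrongDual ℂ (LInf Γ)} (hμ : IsState μ) {h : LInf Γ}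
    (h0 : ∀ s, 0 ≤ h s) (h1 : ∀ s, h s ≤ 1) (f : LInf Γ) : ‖μ (h * f)‖ ≤ ‖μ h‖ * ‖f‖ := by
  have key : ∀ f : LInf Γ, ‖f‖ ≤ 1 → ‖μ (h * f)‖ ≤ ‖μ h‖ := fun f hf => by
    have h2 := norm_add_norm_one_sub_le hμ h0 h1 hf
    rw [map_sub, hμ.2] at h2
    have h3 := norm_sub_norm_le (1 : ℂ) (μ h)
    rw [norm_one] at h3
    linarith
  rcases eq_or_ne f 0 with rfl | hf
  · simp
  have hpos : 0 < ‖f‖ := norm_pos_iff.mpr hf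
  have h2 := key ((‖f‖⁻¹ : ℂ) • f) (by
    rw [norm_smul, norm_inv, Complex.norm_real, norm_norm, inv_mul_cancel₀ hpos.ne'])
  rw [mul_smul_comm, map_smul, norm_smul, norm_inv, Complex.norm_real, norm_norm,
    inv_mul_le_iff₀ hpos] at h2
  linarith

lemma IsState.le_one {μ : StrongDual ℂ (LInf Γ)} (hμ : IsState μ) {h : LInf Γ}
    (h0 : ∀ s, 0 ≤ h s) (h1 : ∀ s, h s ≤ 1) : μ h ≤ 1 := by
  have := hμ.apply_nonneg (h := 1 - h) (fun s => sub_nonneg.mpr (h1 s))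
    (fun s => sub_le_self _ (h0 s))
  rwa [map_sub, hμ.2, sub_nonneg] at this

/-- The state obtained from `μ` by passing to the density `h / μ h`. -/
lemma IsState.density {μ : StrongDual ℂ (LInf Γ)} (hμ : IsState μ) {h : LInf Γ}
    (h0 : ∀ s, 0 ≤ h s) (h1 : ∀ s, h s ≤ 1) (hne : μ h ≠ 0) :
    IsState ((μ h)⁻¹ • μ.comp (ContinuousLinearMap.mul ℂ (LInf Γ) h)) := by
  refine ⟨ContinuousLinearMap.opNorm_le_bound _ zero_le_one fun f => ?_, ?_⟩
  · simp only [_root_.smul_apply, ContinuousLinearMap.comp_apply,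
      ContinuousLinearMap.mul_apply', smul_eq_mul, norm_mul, norm_inv, one_mul]
    rw [inv_mul_le_iff₀ (norm_pos_iff.mpr hne)]
    exact hμ.norm_apply_mul_le h0 h1 f
  · simp [hne]

/-- A state that is multiplicative against all functions with values in `[0, 1]` is
multiplicative against all bounded functions. -/
lemma map_mul_of_unitInterval {μ : StrongDual ℂ (LInf Γ)} {f : LInf Γ} {c : ℂ}
    (hf : ∀ h : LInf Γ, (∀ s, 0 ≤ h s) → (∀ s, h s ≤ 1) → μ (h * f) = μ h * c) (h : LInf Γ) :
    μ (h * f) = μ h * c := by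
  have hreal : ∀ h : LInf Γ, (∀ s, (h s).im = 0) → μ (h * f) = μ h * c := fun h hr => by
    set C : ℝ := ‖h‖ + 1 with hC
    have hCpos : 0 < C := by positivity
    have hCne : (C : ℂ) ≠ 0 := by exact_mod_cast hCpos.ne'
    set k : LInf Γ := ((2 * C : ℝ) : ℂ)⁻¹ • (h + (C : ℂ) • 1) with hk
    have hks : ∀ s, k s = (((2 * C)⁻¹ * ((h s).re + C) : ℝ) : ℂ) := fun s => by
      have : k s = ((2 * C : ℝ) : ℂ)⁻¹ * (h s + (C : ℂ) * 1) := rfl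
      rw [this]
      apply Complex.ext <;> simp [hr s, ← Complex.ofReal_inv]
    have hbd : ∀ s, |(h s).re| ≤ C := fun s =>
      (Complex.abs_re_le_norm _).trans ((LInf.norm_apply_le h s).trans (by simp [hC]))
    have hkey := hf k
      (fun s => by
        rw [hks, Complex.zero_le_real]
        have := neg_le_of_abs_le (hbd s)
        exact mul_nonneg (by positivity) (by linarith))
      (fun s => by
        rw [hks, ← Complex.ofReal_one, Complex.real_le_real, inv_mul_le_iff₀ (by positivity)]
        have := le_of_abs_le (hbd s)
        linarith)
    have hone := hf 1 (fun s => by simp [lp.infty_coeFn_one]) (fun s => by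
      simp [lp.infty_coeFn_one])
    have hh : h = ((2 * C : ℝ) : ℂ) • k - (C : ℂ) • (1 : LInf Γ) := by
      rw [hk, smul_inv_smul₀ (by exact_mod_cast (by positivity : (2 * C : ℝ) ≠ 0))]
      simp
    clear_value k
    rw [hh, sub_mul, smul_mul_assoc, smul_mul_assoc, map_sub, map_sub, map_smul, map_smul,
      map_smul, map_smul, hkey, hone]
    simp only [smul_eq_mul]
    ring
  have e : h = (2⁻¹ : ℂ) • (h + star h) + Complex.I • ((-Complex.I * 2⁻¹) • (h - star h)) := by
    ext s
    change h s = 2⁻¹ * (h s + star (h s)) + Complex.I * ((-Complex.I * 2⁻¹) * (h s - star (h s)))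
    linear_combination ((1 / 2 : ℂ) * (h s - star (h s))) * Complex.I_mul_I
  rw [e, add_mul, smul_mul_assoc Complex.I, map_add, map_add, map_smul, map_smul μ Complex.I,
    hreal, hreal]
  · simp only [smul_eq_mul]
    ring
  · intro s
    change ((-Complex.I * 2⁻¹) * (h s - star (h s))).im = 0
    simp [Complex.mul_im]
  · intro s
    change ((2⁻¹ : ℂ) * (h s + star (h s))).im = 0
    simp [Complex.mul_im]

end States

end RW

namespace RW

section Convolution

variable {Γ : Type*} [Group Γ]

instance : LocallyConvexSpace ℝ (WeakDual ℂ (Op Γ)) :=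
  inferInstanceAs (LocallyConvexSpace ℝ (WeakBilin _))

/-- The convolution of a functional on `ℓ∞(Γ)` with a functional on operators. -/
def conv (μ : StrongDual ℂ (LInf Γ)) (y : WeakDual ℂ (Op Γ)) : WeakDual ℂ (Op Γ) :=
  StrongDual.toWeakDual (μ.comp (orbitMap (WeakDual.toStrongDual y)))

@[simp] lemma conv_apply (μ : StrongDual ℂ (LInf Γ)) (y : WeakDual ℂ (Op Γ)) (T : Op Γ) :
    conv μ y T = μ (orbitMap (WeakDual.toStrongDual y) T) := rfl

/-- The restriction to `ℓ∞(Γ)` of a functional on operators. -/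
def restrict (x : WeakDual ℂ (Op Γ)) : StrongDual ℂ (LInf Γ) :=
  (WeakDual.toStrongDual x).comp mulOp

@[simp] lemma restrict_apply (x : WeakDual ℂ (Op Γ)) (f : LInf Γ) :
    restrict x f = x (mulOp f) := rfl

/-- The states on operators whose restriction to the left regular representation is `φ`. -/
def extensions (φ : Γ → ℂ) : Set (WeakDual ℂ (Op Γ)) :=
  {x | IsState (WeakDual.toStrongDual x) ∧ ∀ g, x (shiftOp g) = φ g}

lemma isCompact_extensions (φ : Γ → ℂ) : IsCompact (extensions φ) := by
  have h : extensions φ = WeakDual.toStrongDual ⁻¹' Metric.closedBall 0 1 ∩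
      ({x | x 1 = 1} ∩ ⋂ g, {x | x (shiftOp g) = φ g}) := by
    ext x
    have hball : WeakDual.toStrongDual x ∈ Metric.closedBall (0 : StrongDual ℂ (Op Γ)) 1 ↔
      ‖WeakDual.toStrongDual x‖ ≤ 1 :=
        @mem_closedBall_zero_iff (StrongDual ℂ (Op Γ)) _ _ 1
    simp only [extensions, IsState, and_assoc, Set.mem_ofPred_eq, Set.mem_inter_iff,
      Set.mem_preimage, Set.mem_iInter, WeakDual.toStrongDual_apply, hball]
  rw [h]
  refine (WeakDual.isCompact_closedBall 0 1).inter_right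
    ((isClosed_eq (WeakDual.eval_continuous _) continuous_const).inter
      (isClosed_iInter fun g => isClosed_eq (WeakDual.eval_continuous _) continuous_const))

lemma convex_extensions (φ : Γ → ℂ) : Convex ℝ (extensions φ) := by
  intro x hx y hy a b ha hb hab
  have hab' : (a : ℂ) + b = 1 := by exact_mod_cast hab
  refine ⟨⟨ContinuousLinearMap.opNorm_le_bound _ zero_le_one fun T => ?_, ?_⟩, fun g => ?_⟩
  · change ‖(a : ℂ) * x T + b * y T‖ ≤ 1 * ‖T‖
    refine (norm_add_le _ _).trans ?_
    rw [norm_mul, norm_mul, Complex.norm_real, Complex.norm_real, Real.norm_of_nonneg ha,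
      Real.norm_of_nonneg hb, ← hab, add_mul]
    gcongr
    · exact hx.1.norm_apply_le T
    · exact hy.1.norm_apply_le T
  · change (a : ℂ) * x 1 + b * y 1 = 1
    rw [show x 1 = 1 from hx.1.2, show y 1 = 1 from hy.1.2, mul_one, mul_one, hab']
  · change (a : ℂ) * x (shiftOp g) + b * y (shiftOp g) = φ g
    rw [hx.2, hy.2, ← add_mul, hab', one_mul]

lemma conv_mem_extensions {φ : Γ → ℂ} (hφ : ∀ g h : Γ, φ (h * g * h⁻¹) = φ g)
    {μ : StrongDual ℂ (LInf Γ)} (hμ : IsState μ) {y : WeakDual ℂ (Op Γ)}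
    (hy : y ∈ extensions φ) : conv μ y ∈ extensions φ := by
  have hone : (1 : LInf Γ) = orbitMap (WeakDual.toStrongDual y) 1 := by
    ext s
    simp [lp.infty_coeFn_one, hy.1.2, -WeakDual.toStrongDual_apply]
  refine ⟨⟨ContinuousLinearMap.opNorm_le_bound _ zero_le_one fun T => ?_, ?_⟩, fun g => ?_⟩
  · refine (hμ.norm_apply_le _).trans ?_
    exact ContinuousLinearMap.le_of_opNorm_le _ ((norm_orbitMap_le _).trans hy.1.1) T
  · change μ (orbitMap _ 1) = 1
    rw [← hone, hμ.2]
  · have : orbitMap (WeakDual.toStrongDual y) (shiftOp g) = φ g • (1 : LInf Γ) := by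
      ext s
      change y (conjOp s⁻¹ (shiftOp g)) = φ g * 1
      rw [conjOp_shiftOp, hy.2, hφ, mul_one]
    rw [conv_apply, this, map_smul, hμ.2, smul_eq_mul, mul_one]

lemma conv_restrict_conv (μ : StrongDual ℂ (LInf Γ)) (x y : WeakDual ℂ (Op Γ)) :
    conv (restrict (conv μ x)) y = conv μ (conv (restrict x) y) := by
  refine ContinuousLinearMap.ext fun T => ?_
  change μ (orbitMap _ (mulOp (orbitMap _ T))) = μ (orbitMap _ T)
  congr 1
  ext s
  change x (conjOp s⁻¹ (mulOp (orbitMap _ T))) = x (mulOp (orbitMap _ (conjOp s⁻¹ T)))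
  rw [conjOp_mulOp, translate_orbitMap]

/-- Closed convex sets of functionals that are stable under convolution by states. -/
structure IsConvStable (D : Set (WeakDual ℂ (Op Γ))) : Prop where
  isClosed : IsClosed D
  convex : Convex ℝ D
  conv_mem : ∀ ⦃μ : StrongDual ℂ (LInf Γ)⦄, IsState μ → ∀ ⦃y⦄, y ∈ D → conv μ y ∈ D

lemma isConvStable_extensions {φ : Γ → ℂ} (hφ : ∀ g h : Γ, φ (h * g * h⁻¹) = φ g) :
    IsConvStable (extensions φ) :=
  ⟨(isCompact_extensions φ).isClosed, convex_extensions φ,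
    fun _ hμ _ hy => conv_mem_extensions hφ hμ hy⟩

lemma exists_minimal_isConvStable {K : Set (WeakDual ℂ (Op Γ))} (hK : IsCompact K)
    (hne : K.Nonempty) (hst : IsConvStable K) :
    ∃ C ⊆ K, C.Nonempty ∧ IsConvStable C ∧
      ∀ D ⊆ C, D.Nonempty → IsConvStable D → D = C := by
  obtain ⟨C, hCK, hC⟩ := zorn_superset_nonempty
    {D : Set (WeakDual ℂ (Op Γ)) | D ⊆ K ∧ D.Nonempty ∧ IsConvStable D} (by
      intro c hc hchain hcne
      obtain ⟨D₀, hD₀⟩ := hcne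
      have : Nonempty c := ⟨⟨D₀, hD₀⟩⟩
      refine ⟨⋂₀ c, ⟨(Set.sInter_subset_of_mem hD₀).trans (hc hD₀).1, ?_, ?_, ?_, ?_⟩,
        fun s hs => Set.sInter_subset_of_mem hs⟩
      · refine IsCompact.nonempty_sInter_of_directed_nonempty_isCompact_isClosed
          (IsChain.directedOn hchain.symm) (fun U hU => (hc hU).2.1)
          (fun U hU => hK.of_isClosed_subset (hc hU).2.2.isClosed (hc hU).1)
          (fun U hU => (hc hU).2.2.isClosed)
      · exact isClosed_sInter fun U hU => (hc hU).2.2.isClosed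
      · exact convex_sInter fun U hU => (hc hU).2.2.convex
      · exact fun μ hμ y hy U hU => (hc hU).2.2.conv_mem hμ (hy U hU))
    K ⟨subset_rfl, hne, hst⟩
  refine ⟨C, hCK, hC.prop.2.1, hC.prop.2.2, fun D hDC hDne hD => ?_⟩
  exact hDC.antisymm (hC.2 ⟨hDC.trans hCK, hDne, hD⟩ hDC)

end Convolution

end RW

namespace RW

section Minimal

variable {Γ : Type*} [Group Γ]

lemma continuous_conv_restrict_apply (y : WeakDual ℂ (Op Γ)) (T : Op Γ) :
    Continuous fun x : WeakDual ℂ (Op Γ) => conv (restrict x) y T :=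
  WeakDual.eval_continuous (mulOp (orbitMap (WeakDual.toStrongDual y) T))

lemma exists_conv_restrict_eq {C : Set (WeakDual ℂ (Op Γ))} (hC : IsCompact C)
    (hst : IsConvStable C) (hstate : ∀ x ∈ C, IsState (WeakDual.toStrongDual x))
    {y : WeakDual ℂ (Op Γ)} (hy : y ∈ C) : ∃ z ∈ C, conv (restrict z) y = z := by
  set R : WeakDual ℂ (Op Γ) → WeakDual ℂ (Op Γ) := fun x => conv (restrict x) y with hR
  have hRC : ∀ x ∈ C, R x ∈ C := fun x hx => hst.conv_mem (hstate x hx).comp_mulOp hy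
  have hiter : ∀ k, R^[k] y ∈ C := fun k => by
    induction k with
    | zero => exact hy
    | succ k ih => rw [Function.iterate_succ_apply']; exact hRC _ ih
  set avg : ℕ → WeakDual ℂ (Op Γ) :=
    fun n => ∑ k ∈ Finset.range (n + 1), ((n + 1 : ℝ)⁻¹) • R^[k] y with havg
  have havgC : ∀ n, avg n ∈ C := fun n => by
    refine hst.convex.sum_mem (fun _ _ => by positivity) ?_ (fun k _ => hiter k)
    rw [Finset.sum_const, Finset.card_range, nsmul_eq_mul]
    push_cast
    exact mul_inv_cancel₀ (by positivity)
  obtain ⟨z, hz, hlim⟩ := hC.ultrafilter_le_nhds ((hyperfilter ℕ).map avg)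
    (le_principal_iff.mpr (Ultrafilter.mem_map.mpr (Filter.univ_mem' havgC)))
  have hlim' : Tendsto avg (hyperfilter ℕ) (𝓝 z) := hlim
  refine ⟨z, hz, ContinuousLinearMap.ext fun T => ?_⟩
  have hsum : ∀ n T, avg n T = ((n + 1 : ℝ)⁻¹ : ℝ) * ∑ k ∈ Finset.range (n + 1), R^[k] y T :=
    fun n T => by
      have : avg n T = ∑ k ∈ Finset.range (n + 1), (((n + 1 : ℝ)⁻¹) • R^[k] y) T :=
        map_sum ((topDualPairing ℂ (Op Γ)).flip T) _ _
      rw [this, Finset.mul_sum]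
      rfl
  have hdiff : ∀ n, R (avg n) T - avg n T =
      ((n + 1 : ℝ)⁻¹ : ℝ) * (R^[n + 1] y T - y T) := fun n => by
    change avg n (mulOp (orbitMap (WeakDual.toStrongDual y) T)) - _ = _
    rw [hsum, hsum, ← mul_sub, ← Finset.sum_sub_distrib]
    congr 1
    rw [show y T = R^[0] y T from rfl, ← Finset.sum_range_sub (fun k => R^[k] y T)]
    refine Finset.sum_congr rfl fun k _ => ?_
    rw [Function.iterate_succ_apply']
    rfl
  have hzero : Tendsto (fun n => R (avg n) T - avg n T) (hyperfilter ℕ) (𝓝 0) := by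
    refine Tendsto.mono_left ?_ Nat.hyperfilter_le_atTop
    have hb : Tendsto (fun n : ℕ => (1 / ((n : ℝ) + 1)) * (2 * ‖T‖)) atTop (𝓝 0) := by
      simpa using tendsto_one_div_add_atTop_nhds_zero_nat.mul_const (2 * ‖T‖)
    refine squeeze_zero_norm (fun n => ?_) hb
    rw [hdiff, norm_mul, Complex.norm_real, Real.norm_of_nonneg (by positivity), one_div]
    gcongr
    refine (norm_sub_le _ _).trans ?_
    have h1 := (hstate _ (hiter (n + 1))).norm_apply_le T
    have h2 := (hstate _ hy).norm_apply_le T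
    simp only [WeakDual.toStrongDual_apply] at h1 h2
    linarith
  have h1 := ((continuous_conv_restrict_apply y T).tendsto z).comp hlim'
  have h2 := ((WeakDual.eval_continuous T).tendsto z).comp hlim'
  exact sub_eq_zero.mp (tendsto_nhds_unique (h1.sub h2) hzero)

lemma isConvStable_setOf_conv_restrict_eq {C : Set (WeakDual ℂ (Op Γ))} (hst : IsConvStable C)
    (y : WeakDual ℂ (Op Γ)) : IsConvStable {x ∈ C | conv (restrict x) y = x} where
  isClosed := by
    have : {x | x ∈ C ∧ conv (restrict x) y = x} = C ∩ ⋂ T, {x | conv (restrict x) y T = x T} := by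
      ext x
      simp only [Set.mem_ofPred_eq, Set.mem_inter_iff, Set.mem_iInter]
      exact and_congr_right fun _ => ContinuousLinearMap.ext_iff
    rw [this]
    exact hst.isClosed.inter (isClosed_iInter fun T =>
      isClosed_eq (continuous_conv_restrict_apply y T) (WeakDual.eval_continuous T))
  convex := by
    intro x hx x' hx' a b ha hb hab
    refine ⟨hst.convex hx.1 hx'.1 ha hb hab, ContinuousLinearMap.ext fun T => ?_⟩
    change (a : ℂ) * conv (restrict x) y T + b * conv (restrict x') y T = a * x T + b * x' T
    rw [hx.2, hx'.2]
  conv_mem := by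
    intro μ hμ x hx
    exact ⟨hst.conv_mem hμ hx.1, by rw [conv_restrict_conv, hx.2]⟩

lemma conv_restrict_eq_of_minimal {C : Set (WeakDual ℂ (Op Γ))} (hC : IsCompact C)
    (hst : IsConvStable C) (hstate : ∀ x ∈ C, IsState (WeakDual.toStrongDual x))
    (hmin : ∀ D ⊆ C, D.Nonempty → IsConvStable D → D = C)
    {x y : WeakDual ℂ (Op Γ)} (hx : x ∈ C) (hy : y ∈ C) : conv (restrict x) y = x := by
  obtain ⟨z, hz, hzy⟩ := exists_conv_restrict_eq hC hst hstate hy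
  rw [← hmin {x ∈ C | conv (restrict x) y = x} (fun _ h => h.1) ⟨z, hz, hzy⟩
    (isConvStable_setOf_conv_restrict_eq hst y)] at hx
  exact hx.2

/-- An extreme point of a minimal convolution-stable set satisfies a multiplicativity
relation against its own orbit functions. -/
lemma restrict_mul_orbitMap_of_extreme {C : Set (WeakDual ℂ (Op Γ))} (hst : IsConvStable C)
    (hstate : ∀ x ∈ C, IsState (WeakDual.toStrongDual x)) {x : WeakDual ℂ (Op Γ)}
    (hx : x ∈ Set.extremePoints ℝ C) (hxx : conv (restrict x) x = x) (T : Op Γ) (h : LInf Γ) :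
    restrict x (h * orbitMap (WeakDual.toStrongDual x) T) = restrict x h * x T := by
  have hμ : IsState (restrict x) := (hstate x hx.1).comp_mulOp
  refine map_mul_of_unitInterval (fun h h0 h1 => ?_) h
  set μ := restrict x with hμdef
  have hTx : ∀ S, μ (orbitMap (WeakDual.toStrongDual x) S) = x S := fun S =>
    DFunLike.congr_fun hxx S
  by_cases hzero : μ h = 0
  · have := hμ.norm_apply_mul_le h0 h1 (orbitMap (WeakDual.toStrongDual x) T)
    rw [hzero, norm_zero, zero_mul, norm_le_zero_iff] at this
    rw [this, hzero, zero_mul]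
  have h0' : ∀ s, 0 ≤ (1 - h) s := fun s => sub_nonneg.mpr (h1 s)
  have h1' : ∀ s, (1 - h) s ≤ 1 := fun s => sub_le_self _ (h0 s)
  by_cases hone : μ (1 - h) = 0
  · have := hμ.norm_apply_mul_le h0' h1' (orbitMap (WeakDual.toStrongDual x) T)
    rw [hone, norm_zero, zero_mul, norm_le_zero_iff, sub_mul, one_mul, map_sub, hTx,
      sub_eq_zero] at this
    rw [map_sub, hμ.2, sub_eq_zero] at hone
    rw [← this, ← hone, one_mul]
  have hp := hμ.density h0 h1 hzero
  have hq := hμ.density h0' h1' hone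
  have hre := hμ.ofReal_re_apply h0 h1
  have hre' := hμ.ofReal_re_apply h0' h1'
  have hpos : 0 < (μ h).re := by
    refine (Complex.nonneg_iff.mp (hμ.apply_nonneg h0 h1)).1.lt_of_ne fun e => hzero ?_
    rw [← hre, ← e, Complex.ofReal_zero]
  have hpos' : 0 < (μ (1 - h)).re := by
    refine (Complex.nonneg_iff.mp (hμ.apply_nonneg h0' h1')).1.lt_of_ne fun e => hone ?_
    rw [← hre', ← e, Complex.ofReal_zero]
  have hleft := (mem_extremePoints_iff_left.mp hx).2 _ (hst.conv_mem hp hx.1) _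
    (hst.conv_mem hq hx.1) ⟨(μ h).re, (μ (1 - h)).re, hpos, hpos', by
      rw [map_sub, hμ.2, Complex.sub_re, Complex.one_re]; ring, by
      refine ContinuousLinearMap.ext fun S => ?_
      change ((μ h).re : ℂ) * ((μ h)⁻¹ * μ (h * orbitMap (WeakDual.toStrongDual x) S)) +
        ((μ (1 - h)).re : ℂ) * ((μ (1 - h))⁻¹ *
          μ ((1 - h) * orbitMap (WeakDual.toStrongDual x) S)) = x S
      rw [hre, hre', mul_inv_cancel_left₀ hzero, mul_inv_cancel_left₀ hone, sub_mul, one_mul,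
        map_sub, hTx]
      ring⟩
  have := DFunLike.congr_fun hleft T
  change (μ h)⁻¹ * μ (h * orbitMap (WeakDual.toStrongDual x) T) = x T at this
  rw [← this, mul_inv_cancel_left₀ hzero]

end Minimal

end RW

namespace RW

section MultiplicativeDomain

variable {Γ : Type*}

lemma eq_zero_of_norm_add_sq_le {w : ℂ} (h : ∀ z : ℂ, ‖w + z‖ ^ 2 ≤ 1 + ‖z‖ ^ 2) : w = 0 := by
  by_contra hw
  have hpos : 0 < ‖w‖ ^ 2 := by positivity
  have h1 := h (((1 / ‖w‖ ^ 2 : ℝ) : ℂ) * w)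
  rw [show w + ((1 / ‖w‖ ^ 2 : ℝ) : ℂ) * w = ((1 + 1 / ‖w‖ ^ 2 : ℝ) : ℂ) * w by push_cast; ring,
    norm_mul, norm_mul, Complex.norm_real, Complex.norm_real, Real.norm_of_nonneg (by positivity),
    Real.norm_of_nonneg (by positivity), mul_pow, mul_pow] at h1
  have h2 : (1 + 1 / ‖w‖ ^ 2) ^ 2 * ‖w‖ ^ 2 = ‖w‖ ^ 2 + 2 + (1 / ‖w‖ ^ 2) ^ 2 * ‖w‖ ^ 2 := by
    field_simp
    ring
  linarith

lemma norm_add_smul_sq_le {V : Type*} [NormedAddCommGroup V] [NormedSpace ℂ V] (z : ℂ) (u v : V) :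
    ‖u + z • v‖ ^ 2 ≤ (1 + ‖z‖ ^ 2) * (‖u‖ ^ 2 + ‖v‖ ^ 2) := by
  have h1 : ‖u + z • v‖ ≤ ‖u‖ + ‖z‖ * ‖v‖ := (norm_add_le _ _).trans_eq (by rw [norm_smul])
  calc ‖u + z • v‖ ^ 2 ≤ (‖u‖ + ‖z‖ * ‖v‖) ^ 2 := by gcongr
    _ ≤ _ := by nlinarith [sq_nonneg (‖z‖ * ‖u‖ - ‖v‖)]

lemma norm_opNorm_sq_le {V : Type*} [NormedAddCommGroup V] [NormedSpace ℂ V] {S : V →L[ℂ] V}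
    {C : ℝ} (hC : 0 ≤ C) (h : ∀ v, ‖S v‖ ^ 2 ≤ C * ‖v‖ ^ 2) : ‖S‖ ^ 2 ≤ C := by
  have : ‖S‖ ≤ √C := S.opNorm_le_bound (Real.sqrt_nonneg _) fun v => by
    refine le_of_sq_le_sq ?_ (by positivity)
    rw [mul_pow, Real.sq_sqrt hC]
    exact h v
  calc ‖S‖ ^ 2 ≤ √C ^ 2 := by gcongr
    _ = C := Real.sq_sqrt hC

variable {a b : LInf Γ}

lemma norm_mulOp_sq_add_le (hab : ∀ s, ‖a s‖ ^ 2 + ‖b s‖ ^ 2 ≤ 1) (v : L2 Γ) :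
    ‖mulOp a v‖ ^ 2 + ‖mulOp b v‖ ^ 2 ≤ ‖v‖ ^ 2 := by
  refine hasSum_le (fun i => ?_) ((L2.hasSum_norm_sq _).add (L2.hasSum_norm_sq _))
    (L2.hasSum_norm_sq v)
  rw [mulOp_apply, mulOp_apply, norm_mul, norm_mul, mul_pow, mul_pow, ← add_mul]
  exact mul_le_of_le_one_left (by positivity) (hab i)

lemma norm_mul_mulOp_add_sq_le (hab : ∀ s, ‖a s‖ ^ 2 + ‖b s‖ ^ 2 ≤ 1) {Q : Op Γ} (hQ : ‖Q‖ ≤ 1)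
    (z : ℂ) : ‖Q * mulOp a + z • mulOp b‖ ^ 2 ≤ 1 + ‖z‖ ^ 2 := by
  refine norm_opNorm_sq_le (by positivity) fun v => ?_
  calc ‖Q (mulOp a v) + z • mulOp b v‖ ^ 2
      ≤ (1 + ‖z‖ ^ 2) * (‖Q (mulOp a v)‖ ^ 2 + ‖mulOp b v‖ ^ 2) := norm_add_smul_sq_le _ _ _
    _ ≤ (1 + ‖z‖ ^ 2) * (‖mulOp a v‖ ^ 2 + ‖mulOp b v‖ ^ 2) := by
        gcongr
        simpa using Q.le_of_opNorm_le hQ (mulOp a v)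
    _ ≤ (1 + ‖z‖ ^ 2) * ‖v‖ ^ 2 := by
        gcongr
        exact norm_mulOp_sq_add_le hab v

lemma norm_mulOp_mul_add_sq_le (hab : ∀ s, ‖a s‖ ^ 2 + ‖b s‖ ^ 2 ≤ 1) {Q : Op Γ} (hQ : ‖Q‖ ≤ 1)
    (z : ℂ) : ‖mulOp a * Q + z • mulOp b‖ ^ 2 ≤ 1 + ‖z‖ ^ 2 := by
  refine norm_opNorm_sq_le (by positivity) fun v => ?_
  have hQv : ‖Q v‖ ≤ ‖v‖ := by simpa using Q.le_of_opNorm_le hQ v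
  have h := L2.norm_sq_le (w := (mulOp a * Q + z • mulOp b) v)
    ((L2.hasSum_norm_sq (Q v)).add ((L2.hasSum_norm_sq v).mul_left (‖z‖ ^ 2))) fun i => by
      change ‖a i * Q v i + z * (b i * v i)‖ ^ 2 ≤ _
      have h1 : ‖a i * Q v i + z * (b i * v i)‖ ≤ ‖a i‖ * ‖Q v i‖ + ‖b i‖ * (‖z‖ * ‖v i‖) :=
        (norm_add_le _ _).trans_eq (by simp only [norm_mul]; ring)
      calc ‖a i * Q v i + z * (b i * v i)‖ ^ 2
          ≤ (‖a i‖ * ‖Q v i‖ + ‖b i‖ * (‖z‖ * ‖v i‖)) ^ 2 := by gcongr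
        _ ≤ (‖a i‖ ^ 2 + ‖b i‖ ^ 2) * (‖Q v i‖ ^ 2 + ‖z‖ ^ 2 * ‖v i‖ ^ 2) := by
            nlinarith [sq_nonneg (‖a i‖ * (‖z‖ * ‖v i‖) - ‖b i‖ * ‖Q v i‖)]
        _ ≤ _ := mul_le_of_le_one_left (by positivity) (hab i)
  calc _ ≤ _ := h
    _ ≤ ‖v‖ ^ 2 + ‖z‖ ^ 2 * ‖v‖ ^ 2 := by gcongr
    _ = _ := by ring

/-- The complementary weight of a bounded function `a` with `‖a‖ ≤ 1`. -/
def coWeight (a : LInf Γ) : LInf Γ :=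
  ⟨fun s => (√(1 - ‖a s‖ ^ 2) : ℝ), LInf.memℓp (C := 1) fun s => by
    rw [Complex.norm_real, Real.norm_of_nonneg (Real.sqrt_nonneg _)]
    exact Real.sqrt_le_one.mpr (sub_le_self _ (by positivity))⟩

lemma coWeight_apply (a : LInf Γ) (s : Γ) : coWeight a s = (√(1 - ‖a s‖ ^ 2) : ℝ) := rfl

lemma norm_sq_add_norm_coWeight_sq (ha : ‖a‖ ≤ 1) (s : Γ) :
    ‖a s‖ ^ 2 + ‖coWeight a s‖ ^ 2 = 1 := by
  have h : ‖a s‖ ^ 2 ≤ 1 := pow_le_one₀ (norm_nonneg _) ((LInf.norm_apply_le a s).trans ha)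
  rw [coWeight_apply, Complex.norm_real, Real.norm_of_nonneg (Real.sqrt_nonneg _),
    Real.sq_sqrt (by linarith)]
  ring

lemma star_mul_self_apply (a : LInf Γ) (s : Γ) : (star a * a) s = ((‖a s‖ ^ 2 : ℝ) : ℂ) := by
  change star (a s) * a s = _
  rw [mul_comm]
  simpa using Complex.mul_conj' (a s)

lemma IsState.apply_coWeight {μ : StrongDual ℂ (LInf Γ)} (hμ : IsState μ) (ha : ‖a‖ ≤ 1)
    (h0 : μ (star a * a) = 0) : μ (coWeight a) = 1 := by
  have hle : ∀ s, ‖a s‖ ^ 2 ≤ 1 := fun s =>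
    pow_le_one₀ (norm_nonneg _) ((LInf.norm_apply_le a s).trans ha)
  have hb0 : ∀ s, 0 ≤ √(1 - ‖a s‖ ^ 2) := fun s => Real.sqrt_nonneg _
  have hb1 : ∀ s, √(1 - ‖a s‖ ^ 2) ≤ 1 := fun s =>
    Real.sqrt_le_one.mpr (sub_le_self _ (by positivity))
  have hsq : ∀ s, √(1 - ‖a s‖ ^ 2) ^ 2 = 1 - ‖a s‖ ^ 2 := fun s =>
    Real.sq_sqrt (by linarith [hle s])
  have happ : ∀ s, (coWeight a - (1 - star a * a)) s =
      ((√(1 - ‖a s‖ ^ 2) - √(1 - ‖a s‖ ^ 2) ^ 2 : ℝ) : ℂ) := fun s => by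
    have e : (coWeight a - (1 - star a * a)) s = coWeight a s - (1 - (star a * a) s) := rfl
    rw [e, star_mul_self_apply, coWeight_apply, hsq]
    push_cast
    ring
  refine le_antisymm (hμ.le_one (fun s => ?_) fun s => ?_) ?_
  · rw [coWeight_apply, Complex.zero_le_real]
    exact hb0 s
  · rw [coWeight_apply, ← Complex.ofReal_one, Complex.real_le_real]
    exact hb1 s
  · have := hμ.apply_nonneg (h := coWeight a - (1 - star a * a))
      (fun s => by
        rw [happ, Complex.zero_le_real]
        nlinarith [hb0 s, hb1 s])
      (fun s => by
        rw [happ, ← Complex.ofReal_one, Complex.real_le_real]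
        nlinarith [hb0 s, hb1 s])
    rwa [map_sub, map_sub, hμ.2, h0, sub_zero, sub_nonneg] at this

/-- A state on operators that vanishes on `|a|²` vanishes on `Q a` and `a Q`. -/
lemma IsState.apply_mul_mulOp_eq_zero {x : StrongDual ℂ (Op Γ)} (hx : IsState x)
    (h0 : x (mulOp (star a * a)) = 0) {Q : Op Γ} (hQ : ‖Q‖ ≤ 1) :
    x (Q * mulOp a) = 0 ∧ x (mulOp a * Q) = 0 := by
  set r : ℂ := ((‖a‖ + 1 : ℝ) : ℂ)⁻¹ with hr
  have hrne : r ≠ 0 := inv_ne_zero (by exact_mod_cast (by positivity : (‖a‖ + 1 : ℝ) ≠ 0))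
  have ha : ‖r • a‖ ≤ 1 := by
    rw [norm_smul, hr, norm_inv, Complex.norm_real, Real.norm_of_nonneg (by positivity),
      inv_mul_le_iff₀ (by positivity)]
    linarith
  have h0' : x.comp mulOp (star (r • a) * (r • a)) = 0 := by
    rw [star_smul, smul_mul_smul_comm, map_smul, ContinuousLinearMap.comp_apply, h0, smul_zero]
  have hb : x (mulOp (coWeight (r • a))) = 1 := hx.comp_mulOp.apply_coWeight ha h0'
  have hab := fun s => (norm_sq_add_norm_coWeight_sq ha s).le
  have key : ∀ S : Op Γ, (∀ z : ℂ, ‖S + z • mulOp (coWeight (r • a))‖ ^ 2 ≤ 1 + ‖z‖ ^ 2) →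
      x S = 0 := fun S hS => eq_zero_of_norm_add_sq_le fun z => by
    refine le_trans ?_ (hS z)
    have := hx.norm_apply_le (S + z • mulOp (coWeight (r • a)))
    rw [map_add, map_smul, hb, smul_eq_mul, mul_one] at this
    gcongr
  constructor
  · have := key _ (norm_mul_mulOp_add_sq_le hab hQ)
    rw [map_smul, mul_smul_comm, map_smul, smul_eq_mul] at this
    exact (mul_eq_zero.mp this).resolve_left hrne
  · have := key _ (norm_mulOp_mul_add_sq_le hab hQ)
    rw [map_smul, smul_mul_assoc, map_smul, smul_eq_mul] at this
    exact (mul_eq_zero.mp this).resolve_left hrne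

end MultiplicativeDomain

section Fixed

variable {Γ : Type*} [Group Γ]

lemma apply_conjOp_eq_of_mul_orbitMap {φ : Γ → ℂ} {x : WeakDual ℂ (Op Γ)} (hx : x ∈ extensions φ)
    (hmul : ∀ T h, restrict x (h * orbitMap (WeakDual.toStrongDual x) T) = restrict x h * x T)
    {g : Γ} (hg : φ g ≠ 0) (T : Op Γ) : x (conjOp g T) = x T := by
  have hstate := hx.1
  have hzero : ∀ T, x (mulOp (star (orbitMap (WeakDual.toStrongDual x) T - x T • 1) *
      (orbitMap (WeakDual.toStrongDual x) T - x T • 1))) = 0 := fun T => by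
    rw [← restrict_apply, mul_sub, map_sub, hmul, mul_smul_comm, mul_one, map_smul, smul_eq_mul]
    ring
  have hl : ∀ T, x (shiftOp g * mulOp (orbitMap (WeakDual.toStrongDual x) T)) = φ g * x T :=
    fun T => by
      have h : x (shiftOp g * mulOp (orbitMap (WeakDual.toStrongDual x) T - x T • 1)) = 0 :=
        (hstate.apply_mul_mulOp_eq_zero (hzero T) (norm_shiftOp_le g)).1
      rw [map_sub, map_smul, mulOp_one, mul_sub, mul_smul_comm, mul_one, map_sub, map_smul,
        hx.2, sub_eq_zero] at h
      rw [h, smul_eq_mul, mul_comm]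
  have hr : ∀ T, x (mulOp (orbitMap (WeakDual.toStrongDual x) T) * shiftOp g) = φ g * x T :=
    fun T => by
      have h : x (mulOp (orbitMap (WeakDual.toStrongDual x) T - x T • 1) * shiftOp g) = 0 :=
        (hstate.apply_mul_mulOp_eq_zero (hzero T) (norm_shiftOp_le g)).2
      rw [map_sub, map_smul, mulOp_one, sub_mul, smul_mul_assoc, one_mul, map_sub, map_smul,
        hx.2, sub_eq_zero] at h
      rw [h, smul_eq_mul, mul_comm]
  have h := hl T
  rw [shiftOp_mul_mulOp, translate_orbitMap, hr] at h
  exact mul_left_cancel₀ hg h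

/-- If a class function extends to a state on operators, it has an extension that is fixed under
conjugation by the support of the function. -/
lemma exists_extension_fixed {φ : Γ → ℂ} (hφ : ∀ g h : Γ, φ (h * g * h⁻¹) = φ g)
    (hne : (extensions φ).Nonempty) :
    ∃ x ∈ extensions φ, ∀ g, φ g ≠ 0 → ∀ T, x (conjOp g T) = x T := by
  obtain ⟨C, hCK, hCne, hst, hmin⟩ := exists_minimal_isConvStable (isCompact_extensions φ) hne
    (isConvStable_extensions hφ)
  have hC : IsCompact C := (isCompact_extensions φ).of_isClosed_subset hst.isClosed hCK
  have hstate : ∀ x ∈ C, IsState (WeakDual.toStrongDual x) := fun x hx => (hCK hx).1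
  obtain ⟨x, hx⟩ := hC.extremePoints_nonempty hCne
  have hxx := conv_restrict_eq_of_minimal hC hst hstate hmin hx.1 hx.1
  exact ⟨x, hCK hx.1, fun g hg T => apply_conjOp_eq_of_mul_orbitMap (hCK hx.1)
    (restrict_mul_orbitMap_of_extreme hst hstate hx hxx) hg T⟩

end Fixed

end RW

namespace RW

section Amenability

variable {Γ : Type*} [Group Γ]

/-- The `N`-equivariant retraction `Γ → N` given by a choice of right coset representatives. -/
def retraction (N : Subgroup Γ) (γ : Γ) : N :=
  ⟨γ * ((Quotient.mk (QuotientGroup.rightRel N) γ).out)⁻¹, by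
    rw [← QuotientGroup.rightRel_apply]
    exact Quotient.mk_out γ⟩

lemma retraction_mul (N : Subgroup Γ) (k : N) (γ : Γ) :
    retraction N (k * γ) = k * retraction N γ := by
  have h : Quotient.mk (QuotientGroup.rightRel N) (k * γ) =
      Quotient.mk (QuotientGroup.rightRel N) γ := Quotient.sound <| by
    change QuotientGroup.rightRel N _ _
    rw [QuotientGroup.rightRel_apply, mul_inv_rev, mul_inv_cancel_left]
    exact N.inv_mem k.2
  ext
  simp only [retraction, h, Subgroup.coe_mul, mul_assoc]

/-- The pullback of bounded real functions along a map. -/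
def pullback {S : Type*} (p : Γ → S) : lp (fun _ : S => ℝ) ∞ →ₗ[ℝ] LInf Γ where
  toFun f := ⟨fun γ => (f (p γ) : ℂ), LInf.memℓp (C := ‖f‖) fun γ => by
    rw [Complex.norm_real]
    exact lp.norm_apply_le_norm (by simp) f (p γ)⟩
  map_add' f g := by
    ext γ
    exact Complex.ofReal_add _ _
  map_smul' c f := by
    ext γ
    exact Complex.ofReal_mul _ _

lemma pullback_apply {S : Type*} (p : Γ → S) (f : lp (fun _ : S => ℝ) ∞) (γ : Γ) :
    pullback p f γ = (f (p γ) : ℂ) := rfl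

lemma isAmenable_of_forall_apply_conjOp {x : StrongDual ℂ (Op Γ)} (hx : IsState x)
    {N : Subgroup Γ} (hN : ∀ g ∈ N, ∀ T, x (conjOp g T) = x T) : IsAmenable N := by
  have hμ := hx.comp_mulOp
  refine ⟨Complex.reLm ∘ₗ ((x.comp mulOp).toLinearMap.restrictScalars ℝ) ∘ₗ
    pullback (retraction N), fun f hf => ?_, ?_, fun k f => ?_⟩
  · change 0 ≤ (x.comp mulOp (pullback (retraction N) f)).re
    have hpos : 0 < ‖f‖ + 1 := by positivity
    have happ : ∀ γ, ((((‖f‖ + 1)⁻¹ : ℝ) : ℂ) • pullback (retraction N) f) γ =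
        (((‖f‖ + 1)⁻¹ * f (retraction N γ) : ℝ) : ℂ) := fun γ =>
      (Complex.ofReal_mul _ _).symm
    have h := hμ.apply_nonneg (h := (((‖f‖ + 1)⁻¹ : ℝ) : ℂ) • pullback (retraction N) f)
      (fun γ => by
        rw [happ, Complex.zero_le_real]
        have := hf (retraction N γ)
        positivity)
      (fun γ => by
        rw [happ, ← Complex.ofReal_one, Complex.real_le_real, inv_mul_le_iff₀ hpos, mul_one]
        have h1 : ‖f (retraction N γ)‖ ≤ ‖f‖ := lp.norm_apply_le_norm (by simp) f _
        exact (Real.le_norm_self _).trans (h1.trans (by simp)))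
    rw [map_smul, smul_eq_mul] at h
    have h2 := (Complex.nonneg_iff.mp h).1
    rw [Complex.re_ofReal_mul] at h2
    exact nonneg_of_mul_nonneg_right h2 (inv_pos.mpr hpos)
  · have : pullback (retraction N) 1 = 1 := by
      ext γ
      simp [pullback_apply, lp.infty_coeFn_one]
    change (x.comp mulOp (pullback (retraction N) 1)).re = 1
    rw [this, hμ.2, Complex.one_re]
  · change (x (mulOp (pullback (retraction N) (lpShift k f)))).re =
      (x (mulOp (pullback (retraction N) f))).re
    have : pullback (retraction N) (lpShift k f) =
        translate (k : Γ) (pullback (retraction N) f) := by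
      ext γ
      change (f (k⁻¹ * retraction N γ) : ℂ) = (f (retraction N ((k : Γ)⁻¹ * γ)) : ℂ)
      rw [← Subgroup.coe_inv, retraction_mul]
    rw [this, ← conjOp_mulOp, hN k k.2]

/-- A class function that extends to a state on operators is supported on the identity when the
amenable radical is trivial. -/
lemma apply_eq_zero_of_extensions_nonempty (hrad : HasTrivialAmenableRadical Γ) {φ : Γ → ℂ}
    (hφ : ∀ g h : Γ, φ (h * g * h⁻¹) = φ g) (hne : (extensions φ).Nonempty) {g : Γ}
    (hg : g ≠ 1) : φ g = 0 := by
  obtain ⟨x, hx, hfix⟩ := exists_extension_fixed hφ hne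
  by_contra hgφ
  have hbot := hrad (Subgroup.normalClosure {g | φ g ≠ 0}) Subgroup.normalClosure_normal
    (isAmenable_of_forall_apply_conjOp hx.1 fun k hk => by
    induction hk using Subgroup.closure_induction with
    | mem k hk =>
      obtain ⟨a, ha, hak⟩ := Group.mem_conjugatesOfSet_iff.mp hk
      obtain ⟨c, rfl⟩ := isConj_iff.mp hak
      exact hfix _ (by rw [hφ]; exact ha)
    | one => simp
    | mul a b _ _ ha hb => intro T; rw [← conjOp_conjOp, ha, hb]
    | inv a _ ha => intro T; rw [← ha (conjOp a⁻¹ T), conjOp_conjOp, mul_inv_cancel, one_conjOp])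
  exact hg (Subgroup.mem_bot.mp (hbot ▸ Subgroup.subset_normalClosure hgφ))

end Amenability

end RW

namespace RW

section Symmetrizable

open scoped InnerProductSpace

lemma le_of_forall_pow_two_pow_le {a b B : ℝ} (hb : 0 ≤ b)
    (h : ∀ k : ℕ, a ^ 2 ^ k ≤ B * b ^ 2 ^ k) : a ≤ b := by
  by_contra! hlt
  have ha : 0 < a := hb.trans_lt hlt
  have hlim : Tendsto (fun k : ℕ => B * (b / a) ^ 2 ^ k) atTop (𝓝 (B * 0)) :=
    ((tendsto_pow_atTop_nhds_zero_of_lt_one (by positivity) ((div_lt_one ha).mpr hlt)).comp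
      (tendsto_pow_atTop_atTop_of_one_lt one_lt_two)).const_mul B
  have := ge_of_tendsto' hlim fun k => (show (1 : ℝ) ≤ B * (b / a) ^ 2 ^ k by
    rw [div_pow, ← mul_div_assoc, one_le_div (by positivity)]
    exact h k)
  linarith

variable {V H : Type*} [SeminormedAddCommGroup V] [InnerProductSpace ℂ V]
  [NormedAddCommGroup H] [InnerProductSpace ℂ H]

lemma norm_pow_apply_le (S : H →L[ℂ] H) (n : ℕ) (v : H) : ‖(S ^ n) v‖ ≤ ‖S‖ ^ n * ‖v‖ := by
  induction n with
  | zero => simp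
  | succ n ih =>
    rw [pow_succ', pow_succ', mul_assoc]
    calc ‖S ((S ^ n) v)‖ ≤ ‖S‖ * ‖(S ^ n) v‖ := S.le_opNorm _
      _ ≤ ‖S‖ * (‖S‖ ^ n * ‖v‖) := by gcongr

lemma inner_pow_apply {P : V →ₗ[ℂ] V} (hP : ∀ u w, ⟪P u, w⟫_ℂ = ⟪u, P w⟫_ℂ) (n : ℕ) (u w : V) :
    ⟪(P ^ n) u, w⟫_ℂ = ⟪u, (P ^ n) w⟫_ℂ := by
  induction n generalizing u w with
  | zero => simp
  | succ n ih =>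
    rw [pow_succ, Module.End.mul_apply, ih, hP, ← Module.End.mul_apply, ← pow_succ', pow_succ]

/-- A linear map that is adjointable for a dominated semi-inner product satisfies the same norm
estimate on unit vectors as in the dominating Hilbert space. -/
lemma norm_apply_le_of_dominated (e : V →ₗ[ℂ] H) {T T' : V →ₗ[ℂ] V} {S S' : H →L[ℂ] H}
    (hT : ∀ v, e (T v) = S (e v)) (hT' : ∀ v, e (T' v) = S' (e v))
    (hadj : ∀ u v, ⟪T u, v⟫_ℂ = ⟪u, T' v⟫_ℂ) (hS : ‖S'‖ ≤ ‖S‖) {C : ℝ}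
    (hC : ∀ v, ‖v‖ ^ 2 ≤ C * ‖e v‖ ^ 2) {v : V} (hv : ‖v‖ = 1) : ‖T v‖ ≤ ‖S‖ := by
  set P : V →ₗ[ℂ] V := T' * T with hPdef
  have hP : ∀ u w, ⟪P u, w⟫_ℂ = ⟪u, P w⟫_ℂ := fun u w => by
    rw [hPdef, Module.End.mul_apply, Module.End.mul_apply, ← hadj,
      ← inner_conj_symm, ← hadj, inner_conj_symm]
  have hinner : ∀ n, ‖(P ^ n) v‖ ^ 2 ≤ ‖(P ^ (2 * n)) v‖ := fun n => by
    have h : ⟪(P ^ n) v, (P ^ n) v⟫_ℂ = ⟪v, (P ^ (2 * n)) v⟫_ℂ := by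
      rw [inner_pow_apply hP, ← Module.End.mul_apply, ← pow_add, two_mul]
    have h2 := norm_inner_le_norm (𝕜 := ℂ) v ((P ^ (2 * n)) v)
    rw [← h, inner_self_eq_norm_sq_to_K, hv, one_mul] at h2
    simpa using h2
  have hpow : ∀ k : ℕ, ‖P v‖ ^ 2 ^ k ≤ ‖(P ^ 2 ^ k) v‖ := fun k => by
    induction k with
    | zero => simp
    | succ k ih =>
      rw [pow_succ 2 k, pow_mul]
      refine (pow_le_pow_left₀ (by positivity) ih 2).trans ?_
      rw [mul_comm (2 ^ k) 2]
      exact hinner _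
  have he : ∀ n, e ((P ^ n) v) = ((S' * S) ^ n) (e v) := fun n => by
    induction n with
    | zero => simp
    | succ n ih =>
      rw [pow_succ', pow_succ', Module.End.mul_apply, hPdef, Module.End.mul_apply, hT', hT,
        ← hPdef, ih]
      rfl
  have hC0 : 0 ≤ C := by
    by_contra! h
    have := hC v
    rw [hv] at this
    nlinarith [sq_nonneg ‖e v‖]
  have hbound : ∀ n, ‖(P ^ n) v‖ ≤ (√C * ‖e v‖) * (‖S‖ ^ 2) ^ n := fun n => by
    refine le_of_sq_le_sq ?_ (by positivity)
    refine (hC _).trans ?_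
    rw [mul_pow, mul_pow, Real.sq_sqrt hC0, he, mul_assoc, ← mul_pow]
    have h1 : ‖S' * S‖ ≤ ‖S‖ ^ 2 := (norm_mul_le _ _).trans (by rw [sq]; gcongr)
    gcongr
    refine (norm_pow_apply_le _ _ _).trans ?_
    rw [mul_comm]
    gcongr
  have hPv : ‖P v‖ ≤ ‖S‖ ^ 2 :=
    le_of_forall_pow_two_pow_le (by positivity) fun k => (hpow k).trans (hbound _)
  have hTv : ‖T v‖ ^ 2 ≤ ‖P v‖ := by
    have h2 := norm_inner_le_norm (𝕜 := ℂ) v (P v)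
    rw [hPdef, Module.End.mul_apply, ← hadj, inner_self_eq_norm_sq_to_K, hv, one_mul] at h2
    simpa [hPdef] using h2
  exact le_of_sq_le_sq (hTv.trans hPv) (norm_nonneg _)

end Symmetrizable

end RW

namespace RW

section MatrixForm

open scoped InnerProductSpace

variable {ι : Type*}

/-- The sesquilinear form of an infinite matrix on finitely supported vectors. -/
def matrixForm (M : Matrix ι ι ℂ) (x y : ι →₀ ℂ) : ℂ :=
  x.sum fun i xi => y.sum fun j yj => star xi * M i j * yj

lemma matrixForm_add_left (M : Matrix ι ι ℂ) (x y z : ι →₀ ℂ) :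
    matrixForm M (x + y) z = matrixForm M x z + matrixForm M y z :=
  Finsupp.sum_add_index' (by simp) fun i a b => by
    simp only [star_add, add_mul, Finsupp.sum_add]

lemma matrixForm_smul_left (M : Matrix ι ι ℂ) (c : ℂ) (x z : ι →₀ ℂ) :
    matrixForm M (c • x) z = star c * matrixForm M x z := by
  rw [matrixForm, Finsupp.sum_smul_index (by simp), matrixForm, Finsupp.mul_sum]
  simp only [star_mul', mul_assoc, Finsupp.mul_sum]

lemma star_matrixForm {M : Matrix ι ι ℂ} (hM : M.IsHermitian) (x y : ι →₀ ℂ) :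
    star (matrixForm M y x) = matrixForm M x y := by
  simp only [matrixForm, Finsupp.sum, star_sum]
  rw [Finset.sum_comm]
  refine Finset.sum_congr rfl fun i _ => Finset.sum_congr rfl fun j _ => ?_
  rw [star_mul', star_mul', star_star, hM.apply]
  ring

lemma matrixForm_sub_matrix (M N : Matrix ι ι ℂ) (x y : ι →₀ ℂ) :
    matrixForm (M - N) x y = matrixForm M x y - matrixForm N x y := by
  simp only [matrixForm, ← Finsupp.sum_sub, Matrix.sub_apply, mul_sub, sub_mul]

lemma matrixForm_smul_matrix (c : ℂ) (M : Matrix ι ι ℂ) (x y : ι →₀ ℂ) :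
    matrixForm (c • M) x y = c * matrixForm M x y := by
  simp only [matrixForm, Finsupp.mul_sum, Matrix.smul_apply, smul_eq_mul]
  refine Finsupp.sum_congr fun i _ => Finsupp.sum_congr fun j _ => ?_
  ring

lemma matrixForm_gram {E : Type*} [NormedAddCommGroup E] [InnerProductSpace ℂ E] (v : ι → E)
    (x : ι →₀ ℂ) : matrixForm (Matrix.gram ℂ v) x x =
      ((‖Finsupp.linearCombination ℂ v x‖ ^ 2 : ℝ) : ℂ) := by
  have h := inner_self_eq_norm_sq_to_K (𝕜 := ℂ) (Finsupp.linearCombination ℂ v x)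
  rw [Finsupp.linearCombination_apply, Finsupp.sum_inner] at h
  rw [Finsupp.linearCombination_apply]
  push_cast
  refine Eq.trans ?_ h
  refine Finset.sum_congr rfl fun i _ => ?_
  beta_reduce
  rw [Finsupp.inner_sum]
  simp only [Finsupp.sum, Matrix.gram_apply, inner_smul_left, inner_smul_right]
  refine Finset.sum_congr rfl fun j _ => ?_
  rw [RCLike.star_def]
  ring

lemma posSemidef_gram {E : Type*} [NormedAddCommGroup E] [InnerProductSpace ℂ E] (v : ι → E) :
    (Matrix.gram ℂ v).PosSemidef :=
  ⟨Matrix.isHermitian_gram ℂ v, fun x => by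
    have := matrixForm_gram v x
    rw [matrixForm] at this
    rw [this, Complex.zero_le_real]
    positivity⟩

/-- The semi-inner product of a positive semidefinite matrix. -/
abbrev formCore {M : Matrix ι ι ℂ} (hM : M.PosSemidef) : PreInnerProductSpace.Core ℂ (ι →₀ ℂ) where
  inner := matrixForm M
  conj_inner_symm x y := star_matrixForm hM.1 x y
  re_inner_nonneg x := (Complex.nonneg_iff.mp (hM.2 x)).1
  add_left := matrixForm_add_left M
  smul_left x y c := matrixForm_smul_left M c x y

end MatrixForm

section Domination

variable {Γ : Type*} [Group Γ]

open scoped InnerProductSpace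

/-- The algebraic left translation. -/
def finShift (g : Γ) : (Γ →₀ ℂ) →ₗ[ℂ] (Γ →₀ ℂ) := Finsupp.lmapDomain ℂ ℂ (g * ·)

lemma matrixForm_finShift {M : Matrix Γ Γ ℂ} {g : Γ} (hM : ∀ i j, M (g * i) j = M i (g⁻¹ * j))
    (x y : Γ →₀ ℂ) : matrixForm M (finShift g x) y = matrixForm M x (finShift g⁻¹ y) := by
  rw [matrixForm, finShift, Finsupp.lmapDomain_apply, Finsupp.sum_mapDomain_index (by simp)
    (fun i a b => by simp only [star_add, add_mul, Finsupp.sum_add]), matrixForm]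
  refine Finsupp.sum_congr fun i _ => ?_
  rw [finShift, Finsupp.lmapDomain_apply, Finsupp.sum_mapDomain_index (by simp)
    (fun i a b => by simp only [mul_add])]
  simp only [hM]

/-- The canonical map from finitely supported functions to `ℓ²`. -/
def toL2 : (Γ →₀ ℂ) →ₗ[ℂ] L2 Γ := by
  classical exact Finsupp.linearCombination ℂ fun g => lp.single 2 g (1 : ℂ)

lemma toL2_finShift (g : Γ) (x : Γ →₀ ℂ) : toL2 (finShift g x) = shiftOp g (toL2 x) := by
  classical
  induction x using Finsupp.induction_linear with
  | zero => simp
  | add x y hx hy => simp only [map_add, hx, hy]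
  | single h c =>
    simp [toL2, finShift, shiftOp_single]

lemma adjoint_linearCombination_shiftOp (a : Γ →₀ ℂ) :
    ContinuousLinearMap.adjoint (Finsupp.linearCombination ℂ (shiftOp (Γ := Γ)) a) =
      a.sum fun g c => star c • shiftOp g⁻¹ := by
  rw [Finsupp.linearCombination_apply, map_finsuppSum]
  refine Finsupp.sum_congr fun g _ => ?_
  rw [map_smulₛₗ, adjoint_shiftOp]
  rfl

/-- A normalized positive definite function that is dominated by a multiple of `δ_1` is bounded by
the norm of the left regular representation. -/
lemma norm_linearCombination_le_of_posSemidef {ω : Γ → ℂ} (hone : ω 1 = 1)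
    (hpos : (Matrix.of fun g h => ω (g⁻¹ * h)).PosSemidef) {w : Γ → L2 Γ}
    (hw : Finsupp.linearCombination ℂ w = toL2) {C : ℝ}
    (hdom : ((C : ℂ) • Matrix.gram ℂ w - Matrix.of fun g h => ω (g⁻¹ * h)).PosSemidef)
    (a : Γ →₀ ℂ) :
    ‖Finsupp.linearCombination ℂ ω a‖ ≤ ‖Finsupp.linearCombination ℂ (shiftOp (Γ := Γ)) a‖ := by
  set M : Matrix Γ Γ ℂ := Matrix.of fun g h => ω (g⁻¹ * h) with hM
  let _ : SeminormedAddCommGroup (Γ →₀ ℂ) :=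
    InnerProductSpace.Core.toSeminormedAddCommGroup (c := formCore hpos)
  let _ : InnerProductSpace ℂ (Γ →₀ ℂ) := InnerProductSpace.ofCore (formCore hpos)
  have hinner : ∀ x y : Γ →₀ ℂ, ⟪x, y⟫_ℂ = matrixForm M x y := fun _ _ => rfl
  have hnorm : ∀ x : Γ →₀ ℂ, ((‖x‖ ^ 2 : ℝ) : ℂ) = matrixForm M x x := fun x => by
    rw [← hinner, inner_self_eq_norm_sq_to_K]
    exact Complex.ofReal_pow _ _
  set T := Finsupp.linearCombination ℂ (finShift (Γ := Γ)) a with hT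
  set T' : (Γ →₀ ℂ) →ₗ[ℂ] (Γ →₀ ℂ) := a.sum fun g c => star c • finShift g⁻¹ with hT'
  set S := Finsupp.linearCombination ℂ (shiftOp (Γ := Γ)) a with hS
  have hshift : ∀ (g : Γ) (x y : Γ →₀ ℂ), ⟪finShift g x, y⟫_ℂ = ⟪x, finShift g⁻¹ y⟫_ℂ :=
    fun g x y => matrixForm_finShift (fun i j => by simp [hM, mul_assoc]) x y
  have hleft : ∀ x : Γ →₀ ℂ, ⟪Finsupp.single 1 1, x⟫_ℂ = Finsupp.linearCombination ℂ ω x :=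
    fun x => by
      rw [hinner, matrixForm, Finsupp.sum_single_index (by simp), Finsupp.linearCombination_apply]
      refine Finsupp.sum_congr fun g _ => ?_
      simp [hM, mul_comm]
  have hv : ‖(Finsupp.single 1 1 : Γ →₀ ℂ)‖ = 1 := by
    have h := hnorm (Finsupp.single 1 1)
    rw [← hinner, hleft, Finsupp.linearCombination_single, hone, smul_eq_mul, one_mul] at h
    have h2 : ‖(Finsupp.single 1 1 : Γ →₀ ℂ)‖ ^ 2 = 1 := by exact_mod_cast h
    exact (pow_eq_one_iff_of_nonneg (norm_nonneg _) two_ne_zero).mp h2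
  have hTv : T (Finsupp.single 1 1) = a := by
    rw [hT, Finsupp.linearCombination_apply, Finsupp.sum, LinearMap.sum_apply]
    simp [finShift, ← Finsupp.sum.eq_1]
  have key := norm_apply_le_of_dominated (V := Γ →₀ ℂ) (H := L2 Γ) toL2 (T := T) (T' := T')
    (S := S) (S' := ContinuousLinearMap.adjoint S) (C := C)
    (fun v => by
      simp only [hT, hS, Finsupp.linearCombination_apply, Finsupp.sum, LinearMap.sum_apply,
        _root_.sum_apply, map_sum, LinearMap.smul_apply, _root_.smul_apply, map_smul,
        toL2_finShift])
    (fun v => by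
      rw [adjoint_linearCombination_shiftOp]
      simp only [hT', Finsupp.sum, LinearMap.sum_apply,
        _root_.sum_apply, map_sum, LinearMap.smul_apply, _root_.smul_apply, map_smul,
        toL2_finShift])
    (fun u v => by
      simp only [hT, hT', Finsupp.linearCombination_apply, Finsupp.sum, LinearMap.sum_apply,
        LinearMap.smul_apply, sum_inner, inner_sum, inner_smul_left, inner_smul_right, hshift]
      rfl)
    (LinearIsometryEquiv.norm_map _ _).le
    (fun v => by
      have h : 0 ≤ matrixForm ((C : ℂ) • Matrix.gram ℂ w - M) v v := hdom.2 v
      rw [matrixForm_sub_matrix, matrixForm_smul_matrix, matrixForm_gram, ← hnorm, hw] at h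
      have h2 : (0 : ℂ) ≤ ((C * ‖toL2 v‖ ^ 2 - ‖v‖ ^ 2 : ℝ) : ℂ) := by
        push_cast at h ⊢
        exact h
      exact sub_nonneg.mp (Complex.zero_le_real.mp h2))
    hv
  rw [hTv] at key
  refine le_trans ?_ key
  rw [← hleft]
  refine (norm_inner_le_norm _ _).trans ?_
  rw [hv, one_mul]

end Domination

end RW

namespace RW

section Day

variable {Γ T : Type*} [Group Γ] [MulAction Γ T] [DecidableEq T]

lemma norm_lp_single_one (t : T) : ‖lp.single (E := fun _ : T => ℝ) 1 t (1 : ℝ)‖ = 1 := by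
  rw [lp.norm_single zero_lt_one]
  simp

/-- Day's trick: an invariant mean produces almost invariant finitely supported probabilities. -/
lemma exists_almost_invariant (hm : HasInvariantMean Γ T) (F : Finset Γ) {ε : ℝ} (hε : 0 < ε) :
    ∃ p : T →₀ ℝ, (∀ t, 0 ≤ p t) ∧ (p.sum fun _ r => r) = 1 ∧
      ∀ g ∈ F, ‖Finsupp.linearCombination ℝ
        (fun t => lp.single (E := fun _ : T => ℝ) 1 (g • t) (1 : ℝ) - lp.single 1 t 1) p‖ < ε := by
  classical
  obtain ⟨m, hpos, hone, hinv⟩ := hm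
  let v : T → (F → lp (fun _ : T => ℝ) 1) := fun t g => lp.single 1 ((g : Γ) • t) 1 - lp.single 1 t 1
  let L : (T →₀ ℝ) →ₗ[ℝ] (F → lp (fun _ : T => ℝ) 1) := Finsupp.linearCombination ℝ v
  have hLapply : ∀ p (g : F), L p g = Finsupp.linearCombination ℝ
      (fun t => lp.single (E := fun _ : T => ℝ) 1 ((g : Γ) • t) (1 : ℝ) - lp.single 1 t 1) p :=
    fun p g => by
      simp only [L, Finsupp.linearCombination_apply, Finsupp.sum, Finset.sum_apply, Pi.smul_apply, v]
  let S : Set (T →₀ ℝ) := {p | (∀ t, 0 ≤ p t) ∧ Finsupp.linearCombination ℝ (fun _ => (1 : ℝ)) p = 1}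
  have hS : Convex ℝ S := by
    rintro p ⟨hp, hp1⟩ q ⟨hq, hq1⟩ a b ha hb hab
    refine ⟨fun t => ?_, ?_⟩
    · exact add_nonneg (mul_nonneg ha (hp t)) (mul_nonneg hb (hq t))
    · rw [map_add, map_smul, map_smul, hp1, hq1]
      simpa using hab
  have hmem : (0 : F → lp (fun _ : T => ℝ) 1) ∈ closure (L '' S) := by
    by_contra h0
    obtain ⟨f, u, hu, hf⟩ := geometric_hahn_banach_point_closed (hS.linear_image L).closure
      isClosed_closure h0
    rw [map_zero] at hu
    let b : F → T → ℝ := fun g t => f (Pi.single g (lp.single 1 t 1))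
    have hb : ∀ g, Memℓp (b g) ∞ := fun g => memℓp_infty ⟨‖f‖, by
      rintro _ ⟨t, rfl⟩
      refine (f.le_opNorm _).trans ?_
      rw [Pi.norm_single, norm_lp_single_one, mul_one]⟩
    let B : F → lp (fun _ : T => ℝ) ∞ := fun g => ⟨b g, hb g⟩
    have hv : ∀ t, f (v t) = ∑ g : F, (b g ((g : Γ) • t) - b g t) := fun t => by
      rw [← Finset.univ_sum_single (v t), map_sum]
      refine Finset.sum_congr rfl fun g _ => ?_
      simp only [v, b, Pi.single_sub, map_sub]
    have hzero : m (∑ g : F, (lpShift (g : Γ)⁻¹ (B g) - B g)) = 0 := by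
      rw [map_sum]
      exact Finset.sum_eq_zero fun g _ => by rw [map_sub, hinv, sub_self]
    have hval : ∀ t, (∑ g : F, (lpShift (g : Γ)⁻¹ (B g) - B g)) t = f (v t) := fun t => by
      rw [hv, lp.coeFn_sum, Finset.sum_apply]
      refine Finset.sum_congr rfl fun g _ => ?_
      rw [lp.coeFn_sub, Pi.sub_apply]
      simp [lpShift, B]
    have h2 := hpos ((∑ g : F, (lpShift (g : Γ)⁻¹ (B g) - B g)) - u • 1) fun t => by
      have hvt : u < f (v t) := hf _ (subset_closure ⟨Finsupp.single t 1,
        ⟨fun s => by rw [Finsupp.single_apply]; split_ifs <;> simp, by simp⟩, by simp [L]⟩)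
      have e : ((∑ g : F, (lpShift (g : Γ)⁻¹ (B g) - B g)) - u • 1 : lp (fun _ : T => ℝ) ∞) t =
        (∑ g : F, (lpShift (g : Γ)⁻¹ (B g) - B g)) t - u * 1 := rfl
      rw [e, hval]
      linarith
    rw [map_sub, hzero, map_smul, hone, smul_eq_mul] at h2
    linarith
  obtain ⟨_, ⟨p, ⟨hp, hp1⟩, rfl⟩, hd⟩ := Metric.mem_closure_iff.mp hmem ε hε
  refine ⟨p, hp, ?_, fun g hg => ?_⟩
  · simpa [Finsupp.linearCombination_apply] using hp1
  · rw [dist_zero_left] at hd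
    rw [← hLapply p ⟨g, hg⟩]
    exact (norm_le_pi_norm _ _).trans_lt hd

end Day

section Overlap

variable {Γ T : Type*} [Group Γ] [MulAction Γ T] [DecidableEq T]

/-- The matrix coefficient of the square root of `p` in the quasi-regular representation. -/
def overlap (p : T →₀ ℝ) (k : Γ) : ℝ :=
  ∑ t ∈ p.support, ∑ s ∈ p.support, if t = k • s then √(p t) * √(p s) else 0

lemma overlap_eq (p : T →₀ ℝ) (k : Γ) :
    overlap p k = ∑ s ∈ p.support, √(p (k • s)) * √(p s) := by
  rw [overlap, Finset.sum_comm]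
  refine Finset.sum_congr rfl fun s _ => ?_
  rw [Finset.sum_ite_eq']
  split_ifs with h
  · rfl
  · simp [Finsupp.notMem_support_iff.mp h]

lemma abs_sub_sqrt_mul_sqrt_le {a b : ℝ} (ha : 0 ≤ a) (hb : 0 ≤ b) :
    |a - √b * √a| ≤ |a - b| := by
  obtain ⟨x, hx, rfl⟩ : ∃ x, 0 ≤ x ∧ x ^ 2 = a := ⟨√a, Real.sqrt_nonneg a, Real.sq_sqrt ha⟩
  obtain ⟨y, hy, rfl⟩ : ∃ y, 0 ≤ y ∧ y ^ 2 = b := ⟨√b, Real.sqrt_nonneg b, Real.sq_sqrt hb⟩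
  rw [Real.sqrt_sq hx, Real.sqrt_sq hy, show x ^ 2 - y * x = x * (x - y) by ring,
    show x ^ 2 - y ^ 2 = (x + y) * (x - y) by ring, abs_mul, abs_mul, abs_of_nonneg hx,
    abs_of_nonneg (add_nonneg hx hy)]
  gcongr
  linarith

lemma abs_one_sub_overlap_le {p : T →₀ ℝ} (hp : ∀ t, 0 ≤ p t) (hp1 : (p.sum fun _ r => r) = 1)
    (g : Γ) : |1 - overlap p g⁻¹| ≤ ‖Finsupp.linearCombination ℝ
        (fun t => lp.single (E := fun _ : T => ℝ) 1 (g • t) (1 : ℝ) - lp.single 1 t 1) p‖ := by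
  set f := Finsupp.linearCombination ℝ
        (fun t => lp.single (E := fun _ : T => ℝ) 1 (g • t) (1 : ℝ) - lp.single 1 t 1) p with hf
  have hval : ∀ s, f s = p (g⁻¹ • s) - p s := fun s => by
    rw [hf, Finsupp.linearCombination_apply, Finsupp.sum, lp.coeFn_sum, Finset.sum_apply]
    have e : ∀ t, (p t • (lp.single 1 (g • t) (1 : ℝ) - lp.single 1 t 1) :
        lp (fun _ : T => ℝ) 1) s =
        (if g⁻¹ • s = t then p t else 0) - if s = t then p t else 0 := fun t => by
      rw [lp.coeFn_smul, Pi.smul_apply, lp.coeFn_sub, Pi.sub_apply, lp.single_apply,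
        lp.single_apply, smul_eq_mul, mul_sub]
      simp only [Pi.single_apply, mul_ite, mul_one, mul_zero, inv_smul_eq_iff]
    simp only [e, Finset.sum_sub_distrib, Finset.sum_ite_eq]
    congr 1 <;> · split_ifs with h
                  · rfl
                  · exact (Finsupp.notMem_support_iff.mp h).symm
  rw [overlap_eq, ← hp1, Finsupp.sum, ← Finset.sum_sub_distrib]
  have hsum := lp.sum_rpow_le_norm_rpow (p := 1) (by simp) f p.support
  simp only [ENNReal.toReal_one, Real.rpow_one] at hsum
  refine (Finset.abs_sum_le_sum_abs _ _).trans (le_trans (Finset.sum_le_sum fun s _ => ?_) hsum)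
  rw [hval, Real.norm_eq_abs, abs_sub_comm (p (g⁻¹ • s))]
  exact abs_sub_sqrt_mul_sqrt_le (hp s) (hp _)

end Overlap

end RW

namespace RW

section PositiveDefinite

variable {Γ : Type*} [Group Γ] {φ : Γ → ℂ}

lemma IsPosDef.map_inv (hpd : IsPosDef φ) (hone : φ 1 = 1) (g : Γ) : φ g⁻¹ = star (φ g) := by
  have h1 := Complex.nonneg_iff.mp (hpd 2 ![g, 1] ![1, 1])
  have h2 := Complex.nonneg_iff.mp (hpd 2 ![g, 1] ![1, Complex.I])
  simp [Fin.sum_univ_two, hone] at h1 h2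
  refine Complex.ext ?_ ?_
  · rw [RCLike.star_def, Complex.conj_re]
    linarith [h2.2]
  · rw [RCLike.star_def, Complex.conj_im]
    linarith [h1.2]

lemma IsPosDef.posSemidef (hpd : IsPosDef φ) (hone : φ 1 = 1) :
    (Matrix.of fun g h => φ (g⁻¹ * h)).PosSemidef := by
  refine ⟨?_, fun x => ?_⟩
  · ext g h
    rw [Matrix.conjTranspose_apply, Matrix.of_apply, Matrix.of_apply, ← hpd.map_inv hone,
      mul_inv_rev, inv_inv]
  · have hsum : ∀ f : Γ → ℂ, ∑ i ∈ x.support, f i = ∑ i, f (x.support.equivFin.symm i) :=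
      fun f => (Finset.sum_coe_sort _ _).symm.trans
        (Equiv.sum_comp x.support.equivFin.symm fun i => f i).symm
    have h := hpd _ (fun i => (x.support.equivFin.symm i : Γ)⁻¹)
      (fun i => x (x.support.equivFin.symm i))
    rw [Finsupp.sum, hsum]
    refine h.trans_eq (Finset.sum_congr rfl fun i _ => ?_)
    rw [Finsupp.sum, hsum]
    refine Finset.sum_congr rfl fun j _ => ?_
    rw [Matrix.of_apply, RCLike.star_def, inv_inv]
    ring

lemma gram_sum_apply {ι κ E : Type*} [NormedAddCommGroup E] [InnerProductSpace ℂ E] (A : Finset κ)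
    (x : κ → ι → E) (i j : ι) : Matrix.gram ℂ (fun i => ∑ t ∈ A, x t i) i j =
      ∑ t ∈ A, ∑ s ∈ A, inner ℂ (x t i) (x s j) := by
  rw [Matrix.gram_apply, sum_inner]
  exact Finset.sum_congr rfl fun t _ => inner_sum _ _ _

/-- Cauchy-Schwarz for sums of Gram matrices. -/
lemma posSemidef_card_smul_sum_gram_sub {ι κ E : Type*} [NormedAddCommGroup E]
    [InnerProductSpace ℂ E] (A : Finset κ) (x : κ → ι → E) :
    ((A.card : ℂ) • ∑ t ∈ A, Matrix.gram ℂ (x t) -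
      Matrix.gram ℂ (fun i => ∑ t ∈ A, x t i)).PosSemidef := by
  have h : ((A.card : ℂ) • ∑ t ∈ A, Matrix.gram ℂ (x t) -
      Matrix.gram ℂ (fun i => ∑ t ∈ A, x t i)) =
      (2⁻¹ : ℂ) • ∑ t ∈ A, ∑ s ∈ A, Matrix.gram ℂ (fun i => x t i - x s i) := by
    ext i j
    rw [Matrix.sub_apply, gram_sum_apply]
    simp only [Matrix.smul_apply, Matrix.sum_apply, Matrix.gram_apply, inner_sub_left,
      inner_sub_right, Finset.sum_sub_distrib, Finset.sum_const, nsmul_eq_mul, smul_eq_mul]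
    rw [Finset.sum_comm (f := fun t s => inner ℂ (x s i) (x t j)), ← Finset.mul_sum]
    ring
  rw [h]
  refine Matrix.PosSemidef.smul (Matrix.posSemidef_sum _ fun t _ => Matrix.posSemidef_sum _
    fun s _ => posSemidef_gram _) ?_
  rw [Complex.nonneg_iff]
  norm_num

end PositiveDefinite

section Rigidity

variable {Γ : Type*} [Group Γ] {Λ : Subgroup Γ} {φ : Γ → ℂ}

lemma apply_eq_zero_of_smul_eq_smul (hchar : ∀ g h : Γ, φ (h * g * h⁻¹) = φ g)
    (hΛ : ∀ h : Γ, h ∈ Λ → h ≠ 1 → φ h = 0) {k : Γ} (hk : k ≠ 1) {t : Γ ⧸ Λ} (ht : k • t = t) :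
    φ k = 0 := by
  induction t using QuotientGroup.induction_on with
  | H x =>
    have hmem : x⁻¹ * (k * x) ∈ Λ := by
      rw [← QuotientGroup.eq]
      exact ht.symm
    have := hchar k x⁻¹
    rw [inv_inv, mul_assoc] at this
    rw [← this]
    refine hΛ _ hmem fun h => hk ?_
    rwa [inv_mul_eq_one, eq_comm, mul_eq_right] at h

open scoped Matrix

lemma norm_linearCombination_overlap_le [DecidableEq (Γ ⧸ Λ)] (hpd : IsPosDef φ) (hone : φ 1 = 1)
    (hchar : ∀ g h : Γ, φ (h * g * h⁻¹) = φ g) (hΛ : ∀ h : Γ, h ∈ Λ → h ≠ 1 → φ h = 0)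
    {p : Γ ⧸ Λ →₀ ℝ} (hp : ∀ t, 0 ≤ p t) (hp1 : (p.sum fun _ r => r) = 1) (a : Γ →₀ ℂ) :
    ‖Finsupp.linearCombination ℂ (fun g => φ g * overlap p g) a‖ ≤
      ‖Finsupp.linearCombination ℂ (shiftOp (Γ := Γ)) a‖ := by
  classical
  let x : Γ ⧸ Λ → Γ → L2 (Γ ⧸ Λ) := fun t g => lp.single 2 (g • t) (√(p t) : ℂ)
  have hx : ∀ t s g h, inner ℂ (x t g) (x s h) =
      if t = (g⁻¹ * h) • s then ((√(p t) * √(p s) : ℝ) : ℂ) else 0 := fun t s g h => by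
    rw [lp.inner_single_left, lp.single_apply, Pi.single_apply, mul_smul]
    simp only [eq_inv_smul_iff]
    split_ifs with he
    · rw [RCLike.inner_apply, Complex.conj_ofReal]
      push_cast
      ring
    · exact inner_zero_right _
  have hM : (Matrix.of fun g h => φ (g⁻¹ * h) * overlap p (g⁻¹ * h)) =
      (Matrix.of fun g h => φ (g⁻¹ * h)) ⊙
        Matrix.gram ℂ (fun g => ∑ t ∈ p.support, x t g) := by
    ext g h
    rw [Matrix.hadamard_apply, gram_sum_apply, Matrix.of_apply, Matrix.of_apply, overlap]
    simp only [hx, Complex.ofReal_sum, apply_ite Complex.ofReal, Complex.ofReal_zero]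
  have hdiag : Matrix.gram ℂ (fun g : Γ => lp.single (E := fun _ : Γ => ℂ) 2 g (1 : ℂ)) =
      (Matrix.of fun g h => φ (g⁻¹ * h)) ⊙ ∑ t ∈ p.support, Matrix.gram ℂ (x t) := by
    ext g h
    rw [Matrix.hadamard_apply, Matrix.gram_apply, Matrix.of_apply, Matrix.sum_apply,
      lp.inner_single_left, lp.single_apply, Pi.single_apply]
    simp only [Matrix.gram_apply, hx]
    rcases eq_or_ne g h with rfl | hgh
    · simp only [inv_mul_cancel, hone, one_smul, if_true, one_mul, ← Complex.ofReal_sum,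
        Real.mul_self_sqrt (hp _)]
      rw [show ∑ t ∈ p.support, p t = 1 from hp1]
      simp
    · rw [if_neg hgh, inner_zero_right, Finset.mul_sum]
      refine (Finset.sum_eq_zero fun t _ => ?_).symm
      split_ifs with ht
      · rw [apply_eq_zero_of_smul_eq_smul hchar hΛ (mt inv_mul_eq_one.mp hgh) ht.symm, zero_mul]
      · exact mul_zero _
  refine norm_linearCombination_le_of_posSemidef (C := p.support.card)
    (w := fun g => lp.single 2 g (1 : ℂ)) ?_ ?_ ?_ ?_ a
  · have h1 : overlap p (1 : Γ) = 1 := by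
      rw [overlap_eq, ← hp1]
      exact Finset.sum_congr rfl fun s _ => by rw [one_smul, Real.mul_self_sqrt (hp s)]
    rw [hone, h1]
    simp
  · rw [hM]
    exact (hpd.posSemidef hone).hadamard (posSemidef_gram _)
  · rfl
  · rw [hM, hdiag, Complex.ofReal_natCast, ← Matrix.hadamard_smul]
    have hsub : ∀ P Q R : Matrix Γ Γ ℂ, P ⊙ Q - P ⊙ R = P ⊙ (Q - R) := fun P Q R => by
      ext g h
      simp only [Matrix.hadamard_apply, Matrix.sub_apply, mul_sub]
    rw [hsub]
    exact (hpd.posSemidef hone).hadamard (posSemidef_card_smul_sum_gram_sub p.support x)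

lemma norm_linearCombination_le (hco : IsCoamenable Λ) (hpd : IsPosDef φ) (hone : φ 1 = 1)
    (hchar : ∀ g h : Γ, φ (h * g * h⁻¹) = φ g) (hΛ : ∀ h : Γ, h ∈ Λ → h ≠ 1 → φ h = 0)
    (a : Γ →₀ ℂ) :
    ‖Finsupp.linearCombination ℂ φ a‖ ≤ ‖Finsupp.linearCombination ℂ (shiftOp (Γ := Γ)) a‖ := by
  classical
  refine le_of_forall_pos_le_add fun ε hε => ?_
  set K := ∑ g ∈ a.support, ‖a g‖ * ‖φ g‖ with hK
  have hK0 : 0 ≤ K := Finset.sum_nonneg fun g _ => by positivity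
  obtain ⟨p, hp, hp1, hinv⟩ := exists_almost_invariant hco (a.support.image (·⁻¹))
    (show 0 < ε / (K + 1) by positivity)
  have hdiff : ‖Finsupp.linearCombination ℂ φ a -
      Finsupp.linearCombination ℂ (fun g => φ g * overlap p g) a‖ ≤ ε := by
    rw [Finsupp.linearCombination_apply, Finsupp.linearCombination_apply, ← Finsupp.sum_sub]
    refine (norm_sum_le _ _).trans (le_trans (Finset.sum_le_sum fun g hg =>
      (?_ : _ ≤ ‖a g‖ * ‖φ g‖ * (ε / (K + 1)))) ?_)
    · have h := (abs_one_sub_overlap_le hp hp1 g⁻¹).trans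
        (hinv _ (Finset.mem_image_of_mem _ hg)).le
      rw [inv_inv] at h
      beta_reduce
      rw [show a g • φ g - a g • (φ g * overlap p g) = a g * φ g * ((1 - overlap p g : ℝ) : ℂ) by
        push_cast
        simp only [smul_eq_mul]
        ring, norm_mul, norm_mul, Complex.norm_real, Real.norm_eq_abs]
      gcongr
    · rw [← Finset.sum_mul, ← hK, mul_div_left_comm]
      exact mul_le_of_le_one_right hε.le ((div_le_one (by positivity)).mpr (by linarith))
  have h := norm_linearCombination_overlap_le hpd hone hchar hΛ hp hp1 a
  have := norm_le_norm_add_norm_sub' (Finsupp.linearCombination ℂ φ a)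
    (Finsupp.linearCombination ℂ (fun g => φ g * overlap p g) a)
  linarith

end Rigidity

end RW

namespace RW

variable {Γ : Type*} [Group Γ] {φ : Γ → ℂ}

lemma extensions_nonempty_of_norm_le (hone : φ 1 = 1)
    (hle : ∀ a : Γ →₀ ℂ, ‖Finsupp.linearCombination ℂ φ a‖ ≤
      ‖Finsupp.linearCombination ℂ (shiftOp (Γ := Γ)) a‖) : (extensions φ).Nonempty := by
  set W := Finsupp.linearCombination ℂ φ
  set L := Finsupp.linearCombination ℂ (shiftOp (Γ := Γ))
  have hker : LinearMap.ker L ≤ LinearMap.ker W := fun a ha => by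
    have h := hle a
    rw [LinearMap.mem_ker.mp ha, norm_zero] at h
    exact norm_le_zero_iff.mp h
  let f : LinearMap.range L →ₗ[ℂ] ℂ :=
    (LinearMap.ker L).liftQ W hker ∘ₗ L.quotKerEquivRange.symm.toLinearMap
  have hf : ∀ a (h : L a ∈ LinearMap.range L), f ⟨L a, h⟩ = W a := fun a h => by
    have : L.quotKerEquivRange.symm ⟨L a, h⟩ = Submodule.Quotient.mk a := by
      rw [LinearEquiv.symm_apply_eq]
      rfl
    simp only [f, LinearMap.comp_apply, LinearEquiv.coe_coe, this]
    rfl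
  obtain ⟨μ, hμ, hnorm⟩ := exists_extension_norm_eq (LinearMap.range L)
    (f.mkContinuous 1 fun y => by
      obtain ⟨_, ⟨a, rfl⟩⟩ := y
      rw [one_mul]
      exact (congrArg norm (hf a _)).trans_le (hle a))
  have hval : ∀ g, μ (shiftOp g) = φ g := fun g => by
    have hg : L (Finsupp.single g 1) = shiftOp g := by simp [L]
    have h := hμ ⟨L (Finsupp.single g 1), LinearMap.mem_range_self _ _⟩
    rw [LinearMap.mkContinuous_apply, hf] at h
    rw [← hg, h]
    simp [W]
  refine ⟨StrongDual.toWeakDual μ, ⟨?_, ?_⟩, hval⟩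
  · exact hnorm.trans_le (LinearMap.mkContinuous_norm_le _ zero_le_one _)
  · have h := hval 1
    rwa [shiftOp_one, hone] at h

end RW

open RW in
/-- Tracial rigidity relative to co-amenable subgroups: every character of a group with
trivial amenable radical which restricts to `δ_e` on a co-amenable subgroup is `δ_e`. -/
theorem coamenable_tracial_rigidity
    {Γ : Type*} [Group Γ] [Countable Γ]
    (hrad : HasTrivialAmenableRadical Γ)
    (Λ : Subgroup Γ) (hco : IsCoamenable Λ)
    (φ : Γ → ℂ) (hpd : IsPosDef φ) (hone : φ 1 = 1)
    (hchar : ∀ g h : Γ, φ (h * g * h⁻¹) = φ g)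
    (hΛ : ∀ h : Γ, h ∈ Λ → h ≠ 1 → φ h = 0) :
    ∀ g : Γ, g ≠ 1 → φ g = 0 := by
  exact fun g hg => apply_eq_zero_of_extensions_nonempty hrad hchar
    (extensions_nonempty_of_norm_le hone (norm_linearCombination_le hco hpd hone hchar hΛ)) hg
end
end

section
/- Let {X_j}_{j∈J} be a countable collection of compact metrizable Γ-spaces, each of which is Γ-mean-proximal. Then the product ∏_{j∈J} X_j equipped with the diagonal Γ-action is Γ-mean-proximal: for every generating μ ∈ Prob(Γ) there is a unique μ-stationary measure on ∏_j X_j, and it makes the product a μ-boundary. -/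
noncomputable section
open scoped ComplexOrder ENNReal
open MeasureTheory Filter Topology
set_option linter.unusedSectionVars false
set_option maxHeartbeats 1000000
set_option synthInstance.maxHeartbeats 400000

namespace RW

section TopMeas

variable {Γ : Type*} [Group Γ] {X : Type*} [TopologicalSpace X] [MeasurableSpace X] [MulAction Γ X]

/-- Weak* convergence of the pushforwards of `ν` under a sequence of group elements
to the Dirac measure at `z`. -/
def TendstoDirac (ν : Measure X) (ws : ℕ → Γ) (z : X) : Prop :=
  ∀ f : C(X, ℝ), Tendsto (fun n => ∫ y, f y ∂(Measure.map (fun x : X => ws n • x) ν))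
    atTop (nhds (f z))

/-- `(X, ν)` is a `μ`-boundary: `ν` is a `μ`-stationary probability measure and for
ℙ_μ-almost every path `ω` of the random walk the measures `(ω_n)_*ν` converge weak* to
a Dirac measure. -/
def IsMuBoundary [MeasurableSpace Γ] (μ : ProbOn Γ) (ν : Measure X) : Prop :=
  IsProbabilityMeasure ν ∧ IsStatMeasure μ ν ∧
  ∀ P : Measure (ℕ → Γ), IsBernoulli μ P →
    ∀ᵐ x ∂P, ∃ z : X, TendstoDirac ν (walk x) z

/-- `(X, ν)` is a `μ`-USB: a `μ`-boundary whose measure is the unique `μ`-stationary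
probability measure on `X`. -/
def IsUSB [MeasurableSpace Γ] (μ : ProbOn Γ) (ν : Measure X) : Prop :=
  IsMuBoundary μ ν ∧
  ∀ ν' : Measure X, IsProbabilityMeasure ν' → IsStatMeasure μ ν' → ν' = ν

/-- The support of a measure: points all of whose neighbourhoods have positive measure. -/
def msupport (ν : Measure X) : Set X := {x : X | ∀ U : Set X, IsOpen U → x ∈ U → 0 < ν U}

/-- `X` is a mean-proximal `Γ`-space: for every generating `μ` there is a unique
`μ`-stationary probability measure, and it makes `X` a `μ`-boundary. -/
def IsMeanProximal (Γ X : Type*) [Group Γ] [MeasurableSpace Γ] [TopologicalSpace X]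
    [MeasurableSpace X] [MulAction Γ X] : Prop :=
  ∀ μ : ProbOn Γ, μ.Generating →
    ∃ ν : Measure X, IsMuBoundary μ ν ∧
      ∀ ν' : Measure X, IsProbabilityMeasure ν' → IsStatMeasure μ ν' → ν' = ν

end TopMeas

end RW

namespace RW

open Measure

section Convolution

variable {Γ : Type*} [Group Γ] [Countable Γ] [MeasurableSpace Γ] [DiscreteMeasurableSpace Γ]

/-- The measure on `Γ` with weights `μ`. -/
def ProbOn.toMeasure (μ : ProbOn Γ) : Measure Γ :=
  Measure.sum fun g => ENNReal.ofReal (μ.w g) • dirac g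

lemma ProbOn.toMeasure_singleton (μ : ProbOn Γ) (g : Γ) :
    μ.toMeasure {g} = ENNReal.ofReal (μ.w g) := by
  classical
  rw [ProbOn.toMeasure, sum_apply _ (measurableSet_singleton g), tsum_eq_single g]
  · simp
  · intro h hne
    simp [hne]

instance (μ : ProbOn Γ) : IsProbabilityMeasure μ.toMeasure := by
  constructor
  rw [ProbOn.toMeasure, sum_apply _ MeasurableSet.univ]
  simp only [Measure.smul_apply, measure_univ, smul_eq_mul, mul_one]
  rw [← ENNReal.ofReal_tsum_of_nonneg μ.nonneg μ.hasSum.summable, μ.hasSum.tsum_eq,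
    ENNReal.ofReal_one]

variable {X : Type*} [MeasurableSpace X] [MulAction Γ X]

/-- The convolution of a measure on the group with a measure on the space acted on. -/
def actConv (m : Measure Γ) (θ : Measure X) : Measure X :=
  (m.prod θ).map fun p => p.1 • p.2

variable [MeasurableConstSMul Γ X]

lemma measurable_smul_prod : Measurable fun p : Γ × X => p.1 • p.2 :=
  measurable_from_prod_countable_right fun g => measurable_const_smul g

instance (m : Measure Γ) (θ : Measure X) [IsProbabilityMeasure m] [IsProbabilityMeasure θ] :
    IsProbabilityMeasure (actConv m θ) :=
  isProbabilityMeasure_map measurable_smul_prod.aemeasurable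

lemma lintegral_actConv (m : Measure Γ) (θ : Measure X) [SFinite θ]
    {f : X → ℝ≥0∞} (hf : Measurable f) :
    ∫⁻ x, f x ∂(actConv m θ) = ∫⁻ g, ∫⁻ y, f (g • y) ∂θ ∂m := by
  rw [actConv, lintegral_map hf measurable_smul_prod,
    lintegral_prod (fun p : Γ × X => f (p.1 • p.2)) (hf.comp measurable_smul_prod).aemeasurable]

lemma actConv_mconv (ρ m : Measure Γ) (θ : Measure X) [SFinite ρ] [SFinite m] [SFinite θ] :
    actConv (ρ ∗ₘ m) θ = actConv ρ (actConv m θ) := by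
  have : SFinite (actConv m θ) := by unfold actConv; infer_instance
  refine ext_of_lintegral _ fun f hf => ?_
  rw [lintegral_actConv _ _ hf, lintegral_actConv _ _ hf,
    lintegral_mconv (Measurable.of_discrete)]
  refine lintegral_congr fun g => ?_
  rw [lintegral_actConv m θ (f := fun y => f (g • y)) (hf.comp (measurable_const_smul g))]
  simp only [mul_smul]

lemma actConv_toMeasure (μ : ProbOn Γ) (θ : Measure X) [SFinite θ] :
    actConv μ.toMeasure θ =
      Measure.sum fun g : Γ => ENNReal.ofReal (μ.w g) • Measure.map (fun x : X => g • x) θ := by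
  refine ext_of_lintegral _ fun f hf => ?_
  rw [lintegral_actConv _ _ hf, ProbOn.toMeasure, lintegral_sum_measure, lintegral_sum_measure]
  refine tsum_congr fun g => ?_
  rw [lintegral_smul_measure, lintegral_smul_measure, lintegral_dirac,
    lintegral_map hf (measurable_const_smul g)]

lemma isStatMeasure_iff_actConv (μ : ProbOn Γ) (θ : Measure X) [SFinite θ] :
    IsStatMeasure μ θ ↔ actConv μ.toMeasure θ = θ := by
  rw [IsStatMeasure, actConv_toMeasure, eq_comm]

lemma map_actConv {Y : Type*} [MeasurableSpace Y] [MulAction Γ Y] [MeasurableConstSMul Γ Y]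
    (m : Measure Γ) (θ : Measure X) [SFinite θ] {p : X → Y} (hp : Measurable p)
    (hequiv : ∀ (g : Γ) (x : X), p (g • x) = g • p x) :
    (actConv m θ).map p = actConv m (θ.map p) := by
  refine ext_of_lintegral _ fun f hf => ?_
  rw [lintegral_map hf hp, lintegral_actConv m θ (f := fun x => f (p x)) (hf.comp hp),
    lintegral_actConv _ _ hf]
  refine lintegral_congr fun g => ?_
  rw [lintegral_map (f := fun y => f (g • y)) (hf.comp (measurable_const_smul g)) hp]
  simp only [hequiv]

lemma integral_actConv (m : Measure Γ) (θ : Measure X) [IsProbabilityMeasure m]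
    [IsProbabilityMeasure θ] {f : X → ℝ} (hf : Integrable f (actConv m θ)) :
    ∫ x, f x ∂(actConv m θ) = ∫ g, ∫ y, f (g • y) ∂θ ∂m := by
  rw [actConv, integral_map measurable_smul_prod.aemeasurable hf.aestronglyMeasurable,
    integral_prod]
  exact (integrable_map_measure hf.aestronglyMeasurable measurable_smul_prod.aemeasurable).1 hf

end Convolution

section Walk

variable {Γ : Type*} [Group Γ]

lemma walk_zero (x : ℕ → Γ) : walk x 0 = 1 := by simp [walk]

lemma walk_succ (x : ℕ → Γ) (n : ℕ) : walk x (n + 1) = walk x n * x n := by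
  simp only [walk]
  rw [List.ofFn_succ', List.concat_eq_append, List.prod_append]
  simp

variable [Countable Γ] [MeasurableSpace Γ] [DiscreteMeasurableSpace Γ]

lemma measurable_walk (n : ℕ) : Measurable fun x : ℕ → Γ => walk x n := by
  induction n with
  | zero => simp only [walk_zero]; exact measurable_const
  | succ n ih => simp only [walk_succ]; fun_prop

/-- The Bernoulli measure on sequences of increments. -/
def ProbOn.bernoulli (μ : ProbOn Γ) : Measure (ℕ → Γ) := infinitePi fun _ => μ.toMeasure

instance (μ : ProbOn Γ) : IsProbabilityMeasure μ.bernoulli := by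
  unfold ProbOn.bernoulli; infer_instance

lemma ProbOn.isBernoulli_bernoulli (μ : ProbOn Γ) : IsBernoulli μ μ.bernoulli := by
  refine ⟨inferInstance, fun n s => ?_⟩
  have hset : {x : ℕ → Γ | ∀ i : Fin n, x (i : ℕ) = s i} =
      Set.pi (Finset.range n) fun i => if h : i < n then {s ⟨i, h⟩} else Set.univ := by
    ext x
    simp only [Set.mem_ofPred_eq, Set.mem_pi, Finset.coe_range, Set.mem_Iio]
    constructor
    · intro h i hi
      simpa [hi] using h ⟨i, hi⟩
    · intro h i
      simpa using h i i.2
  rw [hset, ProbOn.bernoulli, infinitePi_pi _ fun i _ => MeasurableSet.of_discrete,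
    Finset.prod_range]
  simp [ProbOn.toMeasure_singleton]

lemma indepFun_walk (μ : ProbOn Γ) (n : ℕ) :
    ProbabilityTheory.IndepFun (fun x : ℕ → Γ => walk x n) (fun x => x n) μ.bernoulli := by
  have hind : ProbabilityTheory.iIndepFun (fun (i : ℕ) (x : ℕ → Γ) => x i) μ.bernoulli :=
    ProbabilityTheory.iIndepFun_infinitePi (X := fun _ g => g) fun _ => measurable_id
  have h := hind.indepFun_finset (Finset.range n) {n} (by simp) fun i => measurable_pi_apply i
  exact h.comp
    (φ := fun y : Finset.range n → Γ =>
      (List.ofFn fun i : Fin n => y ⟨i, Finset.mem_range.2 i.2⟩).prod)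
    (ψ := fun y : ({n} : Finset ℕ) → Γ => y ⟨n, Finset.mem_singleton_self n⟩)
    Measurable.of_discrete (measurable_pi_apply _)

lemma map_walk_succ (μ : ProbOn Γ) (n : ℕ) :
    μ.bernoulli.map (fun x => walk x (n + 1)) =
      μ.bernoulli.map (fun x => walk x n) ∗ₘ μ.toMeasure := by
  have h := (indepFun_walk μ n).map_mul_eq_map_mconv_map (measurable_walk n)
    (measurable_pi_apply n)
  rw [show μ.bernoulli.map (fun x => x n) = μ.toMeasure from infinitePi_map_eval _ n] at h
  rw [← h]
  congr 1
  ext x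
  exact walk_succ x n

variable {X : Type*} [MeasurableSpace X] [MulAction Γ X] [MeasurableConstSMul Γ X]

lemma isProbabilityMeasure_iterate_actConv (m : Measure Γ) [IsProbabilityMeasure m]
    (θ : Measure X) [IsProbabilityMeasure θ] (n : ℕ) :
    IsProbabilityMeasure ((actConv m)^[n] θ) := by
  induction n with
  | zero => simpa
  | succ n ih => rw [Function.iterate_succ_apply']; infer_instance

lemma iterate_actConv_eq (μ : ProbOn Γ) (n : ℕ) (θ : Measure X) [IsProbabilityMeasure θ] :
    (actConv μ.toMeasure)^[n] θ = actConv (μ.bernoulli.map fun x => walk x n) θ := by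
  induction n generalizing θ with
  | zero =>
    refine ext_of_lintegral _ fun f hf => ?_
    rw [lintegral_actConv _ _ hf, lintegral_map Measurable.of_discrete (measurable_walk 0)]
    simp [walk_zero]
  | succ n ih => rw [Function.iterate_succ_apply, ih, map_walk_succ, actConv_mconv]

lemma integral_iterate_actConv (μ : ProbOn Γ) (n : ℕ) (θ : Measure X) [IsProbabilityMeasure θ]
    {f : X → ℝ} (hf : Measurable f) {C : ℝ} (hC : ∀ x, |f x| ≤ C) :
    ∫ y, f y ∂((actConv μ.toMeasure)^[n] θ) =
      ∫ x, ∫ y, f y ∂(θ.map fun y => walk x n • y) ∂μ.bernoulli := by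
  have := isProbabilityMeasure_map (μ := μ.bernoulli) (measurable_walk n).aemeasurable
  rw [iterate_actConv_eq, integral_actConv, integral_map (measurable_walk n).aemeasurable]
  · refine integral_congr_ae (.of_forall fun x => ?_)
    exact (integral_map (measurable_const_smul _).aemeasurable hf.aestronglyMeasurable).symm
  · exact Measurable.of_discrete.aestronglyMeasurable
  · exact .of_bound hf.aestronglyMeasurable C (.of_forall hC)

end Walk

section Product

variable {J : Type*} {X : J → Type*} [∀ j, TopologicalSpace (X j)]

lemma exists_abs_sub_le_add_sum_dist {X : J → Type*} [∀ j, PseudoMetricSpace (X j)]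
    [CompactSpace (∀ j, X j)] (f : C(∀ j, X j, ℝ)) (z : ∀ j, X j) {ε : ℝ} (hε : 0 < ε) :
    ∃ (F : Finset J) (C : ℝ), ∀ y : ∀ j, X j,
      |f y - f z| ≤ ε + C * ∑ j ∈ F, dist (y j) (z j) := by
  have hmem : f ⁻¹' Metric.ball (f z) ε ∈ 𝓝 z :=
    f.continuous.continuousAt (Metric.ball_mem_nhds _ hε)
  rw [nhds_pi, Filter.mem_pi'] at hmem
  obtain ⟨F, t, ht, hsub⟩ := hmem
  choose δ hδ hball using fun j => Metric.mem_nhds_iff.1 (ht j)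
  have hnonneg : ∀ j ∈ F, 0 ≤ 2 * ‖f‖ / δ j := fun j _ => by have := hδ j; positivity
  refine ⟨F, ∑ j ∈ F, 2 * ‖f‖ / δ j, fun y => ?_⟩
  by_cases h : ∀ j ∈ F, dist (y j) (z j) < δ j
  · have hy : |f y - f z| < ε := hsub fun j hj => hball j (h j hj)
    have := mul_nonneg (Finset.sum_nonneg hnonneg)
      (Finset.sum_nonneg fun j (_ : j ∈ F) => dist_nonneg (x := y j) (y := z j))
    linarith
  · push Not at h
    obtain ⟨j, hj, hle⟩ := h
    have h1 : |f y - f z| ≤ 2 * ‖f‖ := by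
      have := abs_sub (f y) (f z)
      have h2 := f.norm_coe_le_norm y
      have h3 := f.norm_coe_le_norm z
      rw [Real.norm_eq_abs] at h2 h3
      linarith
    have h2 : 2 * ‖f‖ = 2 * ‖f‖ / δ j * δ j := by field_simp [(hδ j).ne']
    have h3 : 2 * ‖f‖ / δ j * δ j ≤
        (∑ j ∈ F, 2 * ‖f‖ / δ j) * ∑ j ∈ F, dist (y j) (z j) :=
      mul_le_mul (Finset.single_le_sum hnonneg hj)
        (hle.trans (Finset.single_le_sum (f := fun j => dist (y j) (z j))
          (fun _ _ => dist_nonneg) hj))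
        (hδ j).le (Finset.sum_nonneg hnonneg)
    linarith

variable {Γ : Type*} [Group Γ] [Countable J] [∀ j, CompactSpace (X j)]
  [∀ j, TopologicalSpace.MetrizableSpace (X j)] [∀ j, MeasurableSpace (X j)] [∀ j, BorelSpace (X j)]
  [∀ j, MulAction Γ (X j)] [∀ j, ContinuousConstSMul Γ (X j)]

lemma tendstoDirac_pi {θ : Measure (∀ j, X j)} [IsProbabilityMeasure θ] {ws : ℕ → Γ}
    {z : ∀ j, X j} (h : ∀ j, TendstoDirac (θ.map fun y => y j) ws (z j)) :
    TendstoDirac θ ws z := by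
  let := fun j => TopologicalSpace.metrizableSpaceMetric (X j)
  have hint : ∀ f : C(∀ j, X j, ℝ), Integrable f θ := fun f =>
    .of_bound f.continuous.measurable.aestronglyMeasurable ‖f‖ (.of_forall f.norm_coe_le_norm)
  have hdist : ∀ j, Tendsto (fun n => ∫ y, dist (ws n • y j) (z j) ∂θ) atTop (𝓝 0) := by
    intro j
    have hj := h j ⟨fun x => dist x (z j), by fun_prop⟩
    simp only [ContinuousMap.coe_mk, dist_self] at hj
    refine hj.congr fun n => ?_
    have hm : Measurable fun x : X j => dist x (z j) :=
      (continuous_id.dist continuous_const).measurable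
    rw [integral_map (measurable_const_smul _).aemeasurable hm.aestronglyMeasurable,
      integral_map (f := fun x => dist (ws n • x) (z j)) (measurable_pi_apply j).aemeasurable
        (hm.comp (measurable_const_smul (ws n))).aestronglyMeasurable]
  intro f
  rw [Metric.tendsto_atTop']
  intro ε hε
  obtain ⟨F, C, hFC⟩ := exists_abs_sub_le_add_sum_dist f z (half_pos hε)
  have hlim : Tendsto (fun n => ε / 2 + C * ∑ j ∈ F, ∫ y, dist (ws n • y j) (z j) ∂θ) atTop
      (𝓝 (ε / 2 + C * ∑ j ∈ F, 0)) :=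
    tendsto_const_nhds.add ((tendsto_finsetSum F fun j _ => hdist j).const_mul C)
  have hlt := hlim.eventually_lt_const (show ε / 2 + C * ∑ j ∈ F, 0 < ε by simp [hε])
  obtain ⟨N, hN⟩ := eventually_atTop.1 hlt
  refine ⟨N, fun n hn => lt_of_le_of_lt ?_ (hN n hn.le)⟩
  have hf : Integrable (fun y => f (ws n • y)) θ :=
    hint ⟨fun y => f (ws n • y), by fun_prop⟩
  have hd : ∀ j ∈ F, Integrable (fun y : ∀ j, X j => dist (ws n • y j) (z j)) θ :=
    fun j _ => hint ⟨fun y => dist (ws n • y j) (z j), by fun_prop⟩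
  have hz : f z = ∫ _, f z ∂θ := by simp
  rw [integral_map (measurable_const_smul _).aemeasurable
    f.continuous.measurable.aestronglyMeasurable, Real.dist_eq, hz,
    ← integral_sub hf (integrable_const _)]
  refine (abs_integral_le_integral_abs).trans ?_
  refine (integral_mono (hf.sub (integrable_const _)).abs
    ((integrable_const _).add ((integrable_finsetSum F hd).const_mul C))
    fun y => hFC (ws n • y)).trans_eq ?_
  simp only [Pi.add_apply]
  rw [integral_add (integrable_const _) ((integrable_finsetSum F hd).const_mul C),
    integral_const_mul, integral_finsetSum F hd]
  simp

end Product

section Stationary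

variable {Γ : Type*} [Group Γ] [Countable Γ] [MeasurableSpace Γ] [DiscreteMeasurableSpace Γ]
  {Y : Type*} [TopologicalSpace Y] [CompactSpace Y] [MeasurableSpace Y] [BorelSpace Y]
  [MulAction Γ Y] [ContinuousConstSMul Γ Y]

lemma tendsto_integral_iterate_actConv (μ : ProbOn Γ) {θ : Measure Y} [IsProbabilityMeasure θ]
    {b : (ℕ → Γ) → Y} (hb : ∀ᵐ x ∂μ.bernoulli, TendstoDirac θ (walk x) (b x)) (f : C(Y, ℝ)) :
    Tendsto (fun n => ∫ y, f y ∂((actConv μ.toMeasure)^[n] θ)) atTop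
      (𝓝 (∫ x, f (b x) ∂μ.bernoulli)) := by
  simp only [fun n => integral_iterate_actConv μ n θ f.continuous.measurable f.norm_coe_le_norm]
  refine tendsto_integral_of_dominated_convergence (fun _ => ‖f‖) (fun n => ?_)
    (integrable_const _) (fun n => .of_forall fun x => ?_) (hb.mono fun x hx => hx f)
  · exact (Measurable.of_discrete (f := fun g : Γ => ∫ y, f y ∂(θ.map fun y => g • y))
      |>.comp (measurable_walk n)).aestronglyMeasurable
  · have := isProbabilityMeasure_map (μ := θ)
      (measurable_const_smul (walk x n)).aemeasurable
    simpa using norm_integral_le_of_norm_le_const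
      (μ := θ.map fun y => walk x n • y) (.of_forall f.norm_coe_le_norm)

variable [TopologicalSpace.MetrizableSpace Y]

lemma actConv_eq_of_tendsto (μ : ProbOn Γ) {θ ν : Measure Y} [IsProbabilityMeasure θ]
    [IsProbabilityMeasure ν]
    (h : ∀ f : C(Y, ℝ), Tendsto (fun n => ∫ y, f y ∂((actConv μ.toMeasure)^[n] θ)) atTop
      (𝓝 (∫ y, f y ∂ν))) :
    actConv μ.toMeasure ν = ν := by
  have hint : ∀ (f : C(Y, ℝ)) (ρ : Measure Y) [IsProbabilityMeasure ρ], Integrable f ρ :=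
    fun f ρ _ => .of_bound f.continuous.measurable.aestronglyMeasurable ‖f‖
      (.of_forall f.norm_coe_le_norm)
  refine ext_of_forall_integral_eq_of_IsFiniteMeasure fun f => ?_
  let f' : C(Y, ℝ) := f.toContinuousMap
  change ∫ y, f' y ∂_ = ∫ y, f' y ∂_
  have := isProbabilityMeasure_iterate_actConv μ.toMeasure θ
  refine tendsto_nhds_unique ?_ ((h f').comp (tendsto_add_atTop_nat 1))
  simp only [Function.comp_def, Function.iterate_succ_apply', integral_actConv _ _ (hint f' _)]
  refine tendsto_integral_of_dominated_convergence (fun _ => ‖f'‖)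
    (fun n => Measurable.of_discrete.aestronglyMeasurable)
    (integrable_const _) (fun n => .of_forall fun g => ?_) (.of_forall fun g => ?_)
  · simpa using norm_integral_le_of_norm_le_const (μ := (actConv μ.toMeasure)^[n] θ)
      (.of_forall fun y => f'.norm_coe_le_norm (g • y))
  · exact h ⟨fun y => f' (g • y), by fun_prop⟩

lemma exists_actConv_eq (μ : ProbOn Γ) {θ : Measure Y} [IsProbabilityMeasure θ]
    {b : (ℕ → Γ) → Y} (hb : ∀ᵐ x ∂μ.bernoulli, TendstoDirac θ (walk x) (b x)) :
    ∃ ν : Measure Y, IsProbabilityMeasure ν ∧ actConv μ.toMeasure ν = ν := by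
  let ρ : ℕ → ProbabilityMeasure Y := fun n =>
    ⟨(actConv μ.toMeasure)^[n] θ, isProbabilityMeasure_iterate_actConv _ _ n⟩
  obtain ⟨ν, -, hν⟩ := isCompact_univ.ultrafilter_le_nhds ((Ultrafilter.of atTop).map ρ) (by simp)
  have hρ : Tendsto ρ ((Ultrafilter.of atTop : Ultrafilter ℕ) : Filter ℕ) (𝓝 ν) := hν
  refine ⟨ν, inferInstance, actConv_eq_of_tendsto μ (θ := θ) fun f => ?_⟩
  have h := tendsto_integral_iterate_actConv μ hb f
  have h' := ProbabilityMeasure.tendsto_iff_forall_integral_tendsto.1 hρ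
    (BoundedContinuousFunction.mkOfCompact f)
  rwa [tendsto_nhds_unique (h.mono_left (Ultrafilter.of_le atTop)) h'] at h

lemma eq_of_actConv_eq (μ : ProbOn Γ) {ν ν' : Measure Y} [IsProbabilityMeasure ν]
    [IsProbabilityMeasure ν'] (hν : actConv μ.toMeasure ν = ν)
    (hν' : actConv μ.toMeasure ν' = ν') {b : (ℕ → Γ) → Y}
    (hb : ∀ᵐ x ∂μ.bernoulli, TendstoDirac ν (walk x) (b x))
    (hb' : ∀ᵐ x ∂μ.bernoulli, TendstoDirac ν' (walk x) (b x)) : ν = ν' := by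
  refine ext_of_forall_integral_eq_of_IsFiniteMeasure fun f => ?_
  have h := tendsto_integral_iterate_actConv μ hb f.toContinuousMap
  have h' := tendsto_integral_iterate_actConv μ hb' f.toContinuousMap
  simp only [Function.iterate_fixed hν, Function.iterate_fixed hν'] at h h'
  exact (tendsto_nhds_unique tendsto_const_nhds h).trans
    (tendsto_nhds_unique h' tendsto_const_nhds)

end Stationary

end RW

open RW in
/-- A countable product of mean-proximal compact metrizable `Γ`-spaces, with the
diagonal action, is mean-proximal. -/
theorem product_of_mean_proximal_is_mean_proximal
    {Γ : Type*} [Group Γ] [Countable Γ] [MeasurableSpace Γ] [DiscreteMeasurableSpace Γ]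
    {J : Type*} [Countable J] (X : J → Type*)
    [∀ j, TopologicalSpace (X j)] [∀ j, CompactSpace (X j)]
    [∀ j, TopologicalSpace.MetrizableSpace (X j)]
    [∀ j, MeasurableSpace (X j)] [∀ j, BorelSpace (X j)]
    [∀ j, MulAction Γ (X j)]
    (hcont : ∀ (j : J) (g : Γ), Continuous fun x : X j => g • x)
    (hmp : ∀ j : J, IsMeanProximal Γ (X j)) :
    IsMeanProximal Γ (∀ j, X j) := by
  have := fun j => (⟨hcont j⟩ : ContinuousConstSMul Γ (X j))
  intro μ hμ
  choose ν hν huniq using fun j => hmp j μ hμ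
  have hprob := fun j => (hν j).1
  have hdirac : ∀ P : Measure (ℕ → Γ), IsBernoulli μ P →
      ∀ᵐ x ∂P, ∃ z : ∀ j, X j, ∀ θ : Measure (∀ j, X j), IsProbabilityMeasure θ →
        (∀ j, θ.map (fun y => y j) = ν j) → TendstoDirac θ (walk x) z := by
    intro P hP
    filter_upwards [ae_all_iff.2 fun j => (hν j).2.2 P hP] with x hx
    choose z hz using hx
    exact ⟨z, fun θ _ hθ => tendstoDirac_pi fun j => by rw [hθ j]; exact hz j⟩
  have hmarg : ∀ θ : Measure (∀ j, X j), IsProbabilityMeasure θ →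
      actConv μ.toMeasure θ = θ → ∀ j, θ.map (fun y => y j) = ν j := by
    intro θ _ hθ j
    have hj := Measure.isProbabilityMeasure_map (μ := θ) (measurable_pi_apply j).aemeasurable
    refine huniq j _ hj ((isStatMeasure_iff_actConv μ _).2 ?_)
    rw [← map_actConv _ _ (measurable_pi_apply j) fun _ _ => rfl, hθ]
  have : ∀ j, Nonempty (X j) := fun j => (ν j).nonempty_of_neZero
  let b : (ℕ → Γ) → ∀ j, X j := fun x => Classical.epsilon fun z =>
    ∀ θ : Measure (∀ j, X j), IsProbabilityMeasure θ →
      (∀ j, θ.map (fun y => y j) = ν j) → TendstoDirac θ (walk x) z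
  have hb : ∀ θ : Measure (∀ j, X j), IsProbabilityMeasure θ →
      (∀ j, θ.map (fun y => y j) = ν j) →
      ∀ᵐ x ∂μ.bernoulli, TendstoDirac θ (walk x) (b x) := fun θ hθ hθν =>
    (hdirac _ μ.isBernoulli_bernoulli).mono fun x hx => Classical.epsilon_spec hx θ hθ hθν
  obtain ⟨ρ, hρ, hρstat⟩ := exists_actConv_eq μ
    (hb (Measure.infinitePi ν) inferInstance fun j => Measure.infinitePi_map_eval ν j)
  have hρν := hmarg ρ hρ hρstat
  refine ⟨ρ, ⟨hρ, (isStatMeasure_iff_actConv μ ρ).2 hρstat, fun P hP => ?_⟩, fun ρ' hρ' hstat => ?_⟩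
  · exact (hdirac P hP).mono fun x ⟨z, hz⟩ => ⟨z, hz ρ hρ hρν⟩
  · have hρ'stat := (isStatMeasure_iff_actConv μ ρ').1 hstat
    exact eq_of_actConv_eq μ hρ'stat hρstat (hb ρ' hρ' (hmarg ρ' hρ' hρ'stat)) (hb ρ hρ hρν)
end
end
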